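/- arXiv:2211.09482 — 3 statements merged into one kernel-verified Lean document; each statement's English description precedes it below -/
import Mathlib

section
/- Let X be a d-dimensional λ-local spectral expander and 0 < η, α < 1. For any A ⊆ X(k) with 0 ≤ k ≤ d−1, if ‖A_σ‖ ≤ 1−α for every σ ∈ X(k−1), then, with S_{k−1} = {σ ∈ X(k−1) : ‖A_σ‖ ≤ η^{1/3}}, it holds that ‖δ₁(A)‖ ≥ (k+1)(k+2)·((1−λ)(1−α−η^{1/3})·‖(A, S_{k−1})‖ − (k/(k+1) − (1−λ)α)·‖A‖). -/
/- Common framework: weighted simplicial complexes, links, localizations,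
   local spectral expansion, cochains, coboundaries, minimality, etc. -/

open Finset

open scoped Classical

namespace HDX

variable {V : Type*} [Fintype V] [DecidableEq V]

/-- The faces of cardinality `m` of a family of finite sets.  (A `k`-dimensional face
has cardinality `k+1`; the `(-1)`-face is the empty set, of cardinality `0`.) -/
def facesCard (Y : Finset (Finset V)) (m : ℕ) : Finset (Finset V) :=
  Y.filter fun s => s.card = m

/-- A simplicial complex: a downwards-closed family of finite sets. -/
def IsComplex (Y : Finset (Finset V)) : Prop :=
  ∀ σ ∈ Y, ∀ τ ⊆ σ, τ ∈ Y

/-- A (pure) `d`-dimensional complex: nonempty, all faces have at most `d+1` vertices, and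
every face is contained in a face with exactly `d+1` vertices (a top face). -/
def IsPureDim (Y : Finset (Finset V)) (d : ℕ) : Prop :=
  Y.Nonempty ∧ (∀ σ ∈ Y, σ.card ≤ d + 1) ∧ ∀ σ ∈ Y, ∃ τ ∈ Y, σ ⊆ τ ∧ τ.card = d + 1

/-- The weight `‖A‖` of a family `A` of faces of cardinality `m`, in a complex whose top
faces have cardinality `t`: pick a top face uniformly at random, then a uniformly random
subset of cardinality `m` of it, and take the probability that it lies in `A`. -/
noncomputable def wt (Y : Finset (Finset V)) (t m : ℕ) (A : Finset (Finset V)) : ℝ :=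
  (∑ σ ∈ facesCard Y t, (((σ.powersetCard m).filter (· ∈ A)).card : ℝ)) /
    (((facesCard Y t).card : ℝ) * (t.choose m : ℝ))

/-- The mutual weight `‖(A,B)‖` of `A` (faces of cardinality `m`) and `B` (faces of
cardinality `l`, `l ≤ m`): the probability that a random `m`-subset of a random top face is
in `A` and a further uniformly random `l`-subset of it is in `B`. -/
noncomputable def mwt (Y : Finset (Finset V)) (t m l : ℕ) (A B : Finset (Finset V)) : ℝ :=
  (∑ σ ∈ facesCard Y t, ∑ τ ∈ (σ.powersetCard m).filter (· ∈ A),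
      (((τ.powersetCard l).filter (· ∈ B)).card : ℝ)) /
    (((facesCard Y t).card : ℝ) * (t.choose m : ℝ) * (m.choose l : ℝ))

/-- Localization of a family `A` to (the link of) a face `σ`:
`A_σ = {τ \ σ | σ ⊆ τ ∈ A}`. -/
def localize (A : Finset (Finset V)) (σ : Finset V) : Finset (Finset V) :=
  (A.filter fun τ => σ ⊆ τ).image fun τ => τ \ σ

/-- The link `X_σ = {τ \ σ | σ ⊆ τ ∈ X}` of a face `σ`. -/
def link (Y : Finset (Finset V)) (σ : Finset V) : Finset (Finset V) :=
  localize Y σ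

/-- `locWt Y t A m σ` is the weight `‖A_σ‖` of the localization to the link of `σ` of the
family `A` of faces of cardinality `m`, where `Y` has top faces of cardinality `t`. -/
noncomputable def locWt (Y : Finset (Finset V)) (t : ℕ) (A : Finset (Finset V)) (m : ℕ)
    (σ : Finset V) : ℝ :=
  wt (link Y σ) (t - σ.card) (m - σ.card) (localize A σ)

/-- `w` is (the weight function of) a weighted graph which is a `λ`-spectral expander:
for every function orthogonal to the constants (in the weighted inner product) the Rayleigh
quotient of the normalized adjacency operator is at most `λ` in absolute value. -/
def IsSpectralExpanderW (w : V → V → ℝ) (lam : ℝ) : Prop :=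
  ∀ f : V → ℝ, (∑ u, (∑ v, w u v) * f u) = 0 →
    |∑ u, ∑ v, w u v * f u * f v| ≤ lam * ∑ u, (∑ v, w u v) * f u ^ 2

/-- The weight of the edge `{u,v}` in the underlying weighted graph of a complex with top
faces of cardinality `t`. -/
noncomputable def edgeWt (Y : Finset (Finset V)) (t : ℕ) (u v : V) : ℝ :=
  if u ≠ v then wt Y t 2 {({u, v} : Finset V)} else 0

/-- `λ`-local spectral expander: the underlying weighted graph of the link of every face of
dimension at most `d-2` (including the empty face) is a `λ`-spectral expander. -/
def IsLocalSpectralExpander (Y : Finset (Finset V)) (d : ℕ) (lam : ℝ) : Prop :=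
  ∀ σ ∈ Y, σ.card + 2 ≤ d + 1 →
    IsSpectralExpanderW (edgeWt (link Y σ) (d + 1 - σ.card)) lam

/-- `q`-bounded degree: every vertex is contained in at most `q` top faces. -/
def IsBoundedDegree (Y : Finset (Finset V)) (d q : ℕ) : Prop :=
  ∀ v : V, ((facesCard Y (d + 1)).filter fun σ => v ∈ σ).card ≤ q

/-- The skeleton consisting of the faces with at most `m` vertices
(i.e. of dimension at most `m - 1`). -/
def skeleton (Y : Finset (Finset V)) (m : ℕ) : Finset (Finset V) :=
  Y.filter fun σ => σ.card ≤ m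

/-- `δ₁(A)`: the faces of cardinality `m+1` that contain exactly one member of `A`
(a family of faces of cardinality `m`). -/
def delta1 (Y : Finset (Finset V)) (m : ℕ) (A : Finset (Finset V)) : Finset (Finset V) :=
  (facesCard Y (m + 1)).filter fun τ => ((τ.powersetCard m).filter (· ∈ A)).card = 1

/-- For `A ⊆ X(k)`, the set `S_{k-1}` of `(k-1)`-faces `σ` with `‖A_σ‖ ≤ η`. -/
noncomputable def nonlocalS (Y : Finset (Finset V)) (t k : ℕ) (A : Finset (Finset V))
    (η : ℝ) : Finset (Finset V) :=
  (facesCard Y k).filter fun σ => locWt Y t A (k + 1) σ ≤ η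

/-- `A ⊆ X(k)` is `(η,ε)`-non-local if `‖(A, S_{k-1})‖ ≥ (1-ε)‖A‖`. -/
def IsNonlocal (Y : Finset (Finset V)) (t k : ℕ) (A : Finset (Finset V)) (η ε : ℝ) : Prop :=
  mwt Y t (k + 1) k A (nonlocalS Y t k A η) ≥ (1 - ε) * wt Y t (k + 1) A

/-- For `A ⊆ X(k)`, the set `S_{k-2}` of `(k-2)`-faces `σ` with `‖A_σ‖ ≤ η`. -/
noncomputable def weakS (Y : Finset (Finset V)) (t k : ℕ) (A : Finset (Finset V))
    (η : ℝ) : Finset (Finset V) :=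
  (facesCard Y (k - 1)).filter fun σ => locWt Y t A (k + 1) σ ≤ η

/-- `A ⊆ X(k)` is `(η,ε,α)`-weakly-non-local if `‖S_{k-2}‖ ≥ 1 - ε‖A‖` and `‖A_τ‖ ≤ 1-α`
for every `(k-1)`-face `τ`. -/
def IsWeaklyNonlocal (Y : Finset (Finset V)) (t k : ℕ) (A : Finset (Finset V))
    (η ε α : ℝ) : Prop :=
  wt Y t (k - 1) (weakS Y t k A η) ≥ 1 - ε * wt Y t (k + 1) A ∧
    ∀ τ ∈ facesCard Y k, locWt Y t A (k + 1) τ ≤ 1 - α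

section Abelian

variable {G : Type*} [AddCommGroup G]

/-- An ordered face of the complex: an injective tuple whose image is a face. -/
def IsFaceTup (Y : Finset (Finset V)) {m : ℕ} (tup : Fin m → V) : Prop :=
  Function.Injective tup ∧ Finset.image tup Finset.univ ∈ Y

/-- A cochain over an abelian group `G` on the faces with `m` vertices (i.e. an
`(m-1)`-dimensional cochain): an antisymmetric `G`-valued function on ordered faces,
vanishing on tuples which are not ordered faces. -/
def IsCochain (Y : Finset (Finset V)) {m : ℕ} (f : (Fin m → V) → G) : Prop :=
  (∀ (tup : Fin m → V) (π : Equiv.Perm (Fin m)),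
      f (tup ∘ π) = ((Equiv.Perm.sign π : ℤˣ) : ℤ) • f tup) ∧
    ∀ tup : Fin m → V, ¬IsFaceTup Y tup → f tup = 0

/-- The coboundary operator `δ(f)(v_0,…,v_m) = ∑ i, (-1)^i f(v_0,…,v_{i-1},v_{i+1},…,v_m)`. -/
def cob {m : ℕ} (f : (Fin m → V) → G) : (Fin (m + 1) → V) → G := fun tup =>
  ∑ i : Fin (m + 1), ((-1 : ℤ) ^ (i : ℕ)) • f (tup ∘ i.succAbove)

/-- The support of `f`: the faces (with `m` vertices) on which `f` does not vanish. -/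
noncomputable def suppC (Y : Finset (Finset V)) {m : ℕ} (f : (Fin m → V) → G) :
    Finset (Finset V) :=
  (facesCard Y m).filter fun σ =>
    ∃ tup : Fin m → V, Finset.image tup Finset.univ = σ ∧ f tup ≠ 0

/-- The norm `‖f‖` of a cochain: the weight of its support. -/
noncomputable def normC (Y : Finset (Finset V)) (t : ℕ) {m : ℕ} (f : (Fin m → V) → G) : ℝ :=
  wt Y t m (suppC Y f)

/-- A cocycle: a cochain whose coboundary vanishes on all (ordered) faces. -/
def IsCocycle (Y : Finset (Finset V)) {m : ℕ} (f : (Fin m → V) → G) : Prop :=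
  IsCochain Y f ∧ ∀ tup : Fin (m + 1) → V, IsFaceTup Y tup → cob f tup = 0

/-- A coboundary: a function agreeing on all ordered faces with the coboundary of a cochain
of one dimension below. -/
def IsCoboundaryFn (Y : Finset (Finset V)) {m : ℕ} (f : (Fin (m + 1) → V) → G) : Prop :=
  ∃ g : (Fin m → V) → G, IsCochain Y g ∧
    ∀ tup : Fin (m + 1) → V, IsFaceTup Y tup → f tup = cob g tup

/-- The distance of `f` from the coboundaries. -/
noncomputable def distB (Y : Finset (Finset V)) (t : ℕ) {m : ℕ}
    (f : (Fin (m + 1) → V) → G) : ℝ :=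
  sInf {r : ℝ | ∃ g : (Fin m → V) → G, IsCochain Y g ∧
    r = normC Y t fun tup => f tup - cob g tup}

/-- The distance of `f` from the cocycles. -/
noncomputable def distZ (Y : Finset (Finset V)) (t : ℕ) {m : ℕ}
    (f : (Fin m → V) → G) : ℝ :=
  sInf {r : ℝ | ∃ g : (Fin m → V) → G, IsCocycle Y g ∧
    r = normC Y t fun tup => f tup - g tup}

/-- A minimal cochain: its weight cannot be decreased by adding a coboundary. -/
def IsMinimal (Y : Finset (Finset V)) (t : ℕ) {m : ℕ} (f : (Fin (m + 1) → V) → G) : Prop :=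
  ∀ g : (Fin m → V) → G, IsCochain Y g →
    normC Y t f ≤ normC Y t fun tup => f tup - cob g tup

/-- The localization `f_v` of a cochain to the link of a vertex `v`: `f_v(τ) = f(vτ)`. -/
def localizeC {m : ℕ} (f : (Fin (m + 1) → V) → G) (v : V) : (Fin m → V) → G :=
  fun tup => f (Fin.cons v tup)

/-- A locally minimal cochain: all its localizations to links of vertices are minimal. -/
def IsLocallyMinimal (Y : Finset (Finset V)) (t : ℕ) {m : ℕ}
    (f : (Fin (m + 2) → V) → G) : Prop :=
  ∀ v : V, ({v} : Finset V) ∈ Y → IsMinimal (link Y {v}) (t - 1) (localizeC f v)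

/-- A `β`-coboundary expander over `G` (for a complex with top faces of cardinality `t`):
for every dimension below the dimension of the complex, every cochain which is not a
coboundary satisfies `‖δ(f)‖ ≥ β · dist(f, B)`. -/
def IsCoboundaryExpander (Y : Finset (Finset V)) (t : ℕ) (G : Type*) [AddCommGroup G]
    (β : ℝ) : Prop :=
  ∀ m : ℕ, m + 2 ≤ t → ∀ f : (Fin (m + 1) → V) → G, IsCochain Y f → ¬IsCoboundaryFn Y f →
    normC Y t (cob f) ≥ β * distB Y t f

/-- The links (of all nonempty faces) of `Y` are `β`-coboundary expanders over `G`. -/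
def HasCobExpandingLinks (Y : Finset (Finset V)) (d : ℕ) (G : Type*) [AddCommGroup G]
    (β : ℝ) : Prop :=
  ∀ σ ∈ Y, σ.Nonempty → IsCoboundaryExpander (link Y σ) (d + 1 - σ.card) G β

/-- For a family `A` of faces with `c` vertices (i.e. `A ⊆ X(k)` with `c = k+1`),
`Sbar Y t c A η r` is the set `S̄_{k-1-r}` of "fat" faces of cardinality `c-1-r`:
`S̄_{k-1} = {σ ∈ X(k-1) : ‖A_σ‖ > η}` and, going down,
`S̄_i = {σ ∈ X(i) : ‖(S̄_{i+1})_σ‖ > η^{2^{k-i-1}}}`. -/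
noncomputable def Sbar (Y : Finset (Finset V)) (t c : ℕ) (A : Finset (Finset V)) (η : ℝ) :
    ℕ → Finset (Finset V)
  | 0 => (facesCard Y (c - 1)).filter fun σ => η < locWt Y t A c σ
  | r + 1 =>
      (facesCard Y (c - 1 - (r + 1))).filter fun σ =>
        η ^ 2 ^ (r + 1) < locWt Y t (Sbar Y t c A η r) (c - 1 - r) σ

/-- `Υ`: the set of `(k+1)`-faces (cardinality `c+1`, where `c = k+1`) containing two
`i`-faces `σ, σ' ∈ S̄_i` (for some `i ≥ 0`) with `σ ∪ σ' ∈ X(i+1)` and `σ ∩ σ' ∈ S_{i-1}`. -/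
noncomputable def Upsilon (Y : Finset (Finset V)) (t c : ℕ) (A : Finset (Finset V))
    (η : ℝ) : Finset (Finset V) :=
  (facesCard Y (c + 1)).filter fun τ => ∃ r : ℕ, r + 2 ≤ c ∧
    ∃ σ ∈ Sbar Y t c A η r, ∃ σ' ∈ Sbar Y t c A η r, σ ⊆ τ ∧ σ' ⊆ τ ∧
      σ ∪ σ' ∈ facesCard Y (c - r) ∧
      σ ∩ σ' ∈ facesCard Y (c - 2 - r) \ Sbar Y t c A η (r + 1)

/-- `f↓σ` (for `σ` of cardinality `c-1-r`, i.e. an `(k-r)`-dimensional... face): the members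
`τ` of `A` admitting a chain of containments `τ ⊃ τ_{k-1} ⊃ ⋯ ⊃ τ_{i+1} ⊃ σ` with each
`τ_j ∈ S̄_j`. -/
noncomputable def fdown (Y : Finset (Finset V)) (t c : ℕ) (A : Finset (Finset V)) (η : ℝ) :
    ℕ → Finset V → Finset (Finset V)
  | 0, σ => A.filter fun τ => σ ⊆ τ
  | r + 1, σ =>
      A.filter fun τ => ∃ τ' ∈ Sbar Y t c A η r, σ ⊆ τ' ∧ τ' ≠ σ ∧ τ ∈ fdown Y t c A η r τ'

end Abelian

section NonAbelian

variable {G : Type*} [Group G]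

/-- A 0-cochain over a (possibly non-abelian) group: vanishes on non-vertices. -/
def IsC0 (Y : Finset (Finset V)) (f : V → G) : Prop :=
  ∀ v : V, ({v} : Finset V) ∉ Y → f v = 1

/-- A 1-cochain over a (possibly non-abelian) group: antisymmetric, supported on edges. -/
def IsC1 (Y : Finset (Finset V)) (g : V → V → G) : Prop :=
  (∀ u v : V, g v u = (g u v)⁻¹) ∧
    ∀ u v : V, ({u, v} : Finset V) ∉ Y ∨ u = v → g u v = 1

/-- A 2-cochain over a (possibly non-abelian) group: antisymmetric, supported on triangles. -/
def IsC2 (Y : Finset (Finset V)) (f : V → V → V → G) : Prop :=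
  (∀ u v w : V, f u v w = f v w u) ∧ (∀ u v w : V, f v u w = (f u v w)⁻¹) ∧
    ∀ u v w : V, ({u, v, w} : Finset V) ∉ Y ∨ u = v ∨ u = w ∨ v = w → f u v w = 1

/-- The coboundary of a 0-cochain: `δ(f)(u,v) = f(u)·f(v)⁻¹`. -/
def d0 (f : V → G) : V → V → G := fun u v => f u * (f v)⁻¹

/-- The coboundary of a 1-cochain: `δ(g)(u,v,w) = g(u,v)·g(v,w)·g(w,u)`. -/
def d1 (g : V → V → G) : V → V → V → G := fun u v w => g u v * g v w * g w u

/-- The support (a set of vertices, as singleton faces) of a `G`-valued function. -/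
noncomputable def supp0 (Y : Finset (Finset V)) (f : V → G) : Finset (Finset V) :=
  (facesCard Y 1).filter fun s => ∃ v : V, ({v} : Finset V) = s ∧ f v ≠ 1

/-- The support (a set of edges) of a `G`-valued function on ordered edges. -/
noncomputable def supp1 (Y : Finset (Finset V)) (g : V → V → G) : Finset (Finset V) :=
  (facesCard Y 2).filter fun e => ∃ u v : V, ({u, v} : Finset V) = e ∧ u ≠ v ∧ g u v ≠ 1

/-- The support (a set of triangles) of a `G`-valued function on ordered triangles. -/
noncomputable def supp2 (Y : Finset (Finset V)) (f : V → V → V → G) : Finset (Finset V) :=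
  (facesCard Y 3).filter fun s =>
    ∃ u v w : V, ({u, v, w} : Finset V) = s ∧ u ≠ v ∧ u ≠ w ∧ v ≠ w ∧ f u v w ≠ 1

/-- The action of 0-cochains on 1-cochains: `h.g(u,v) = h(u)·g(u,v)·h(v)⁻¹`. -/
def act (h : V → G) (g : V → V → G) : V → V → G := fun u v => h u * g u v * (h v)⁻¹

/-- The norm of a 1-cochain: the weight of its support. -/
noncomputable def norm1 (Y : Finset (Finset V)) (t : ℕ) (g : V → V → G) : ℝ :=
  wt Y t 2 (supp1 Y g)

/-- The norm of a 2-cochain: the weight of its support. -/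
noncomputable def norm2 (Y : Finset (Finset V)) (t : ℕ) (f : V → V → V → G) : ℝ :=
  wt Y t 3 (supp2 Y f)

/-- The distance between two 1-cochains: `dist(g,g') = ‖g'g⁻¹‖`. -/
noncomputable def dist1 (Y : Finset (Finset V)) (t : ℕ) (g g' : V → V → G) : ℝ :=
  norm1 Y t fun u v => g' u v * (g u v)⁻¹

/-- A minimal 1-cochain: its weight cannot be decreased by acting with a 0-cochain. -/
def Minimal1 (Y : Finset (Finset V)) (t : ℕ) (g : V → V → G) : Prop :=
  ∀ h : V → G, IsC0 Y h → norm1 Y t g ≤ norm1 Y t (act h g)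

/-- The localization `f_v` of a 2-cochain to the link of `v`: `f_v(u,w) = f(v,u,w)`. -/
def locC1 (f : V → V → V → G) (v : V) : V → V → G := fun u w => f v u w

/-- A locally minimal 2-cochain: all its localizations to links of vertices are minimal. -/
def LocallyMinimal2 (Y : Finset (Finset V)) (t : ℕ) (f : V → V → V → G) : Prop :=
  ∀ v : V, ({v} : Finset V) ∈ Y → Minimal1 (link Y {v}) (t - 1) (locC1 f v)

/-- A 1-coboundary: `g = δ(h)` on the edges, for some 0-cochain `h`. -/
def IsCoboundary1 (Y : Finset (Finset V)) (g : V → V → G) : Prop :=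
  ∃ h : V → G, IsC0 Y h ∧
    ∀ u v : V, ({u, v} : Finset V) ∈ Y → u ≠ v → g u v = h u * (h v)⁻¹

/-- A 1-cocycle: a 1-cochain whose coboundary is trivial on all triangles. -/
def IsCocycle1 (Y : Finset (Finset V)) (g : V → V → G) : Prop :=
  IsC1 Y g ∧ ∀ u v w : V, ({u, v, w} : Finset V) ∈ Y → u ≠ v → u ≠ w → v ≠ w →
    d1 g u v w = 1

/-- A constant 0-cochain (member of `B⁰`). -/
def IsConst0 (Y : Finset (Finset V)) (f : V → G) : Prop :=
  ∃ c : G, ∀ v : V, ({v} : Finset V) ∈ Y → f v = c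

/-- The distance of a 0-cochain from `B⁰` (the constants). -/
noncomputable def distB0 (Y : Finset (Finset V)) (t : ℕ) (f : V → G) : ℝ :=
  sInf {r : ℝ | ∃ c : G, r = wt Y t 1 (supp0 Y fun v => f v * c⁻¹)}

/-- The distance of a 1-cochain from the 1-coboundaries. -/
noncomputable def distB1 (Y : Finset (Finset V)) (t : ℕ) (g : V → V → G) : ℝ :=
  sInf {r : ℝ | ∃ h : V → G, IsC0 Y h ∧ r = dist1 Y t g (act h g)}

/-- The distance of a 1-cochain from the 1-cocycles. -/
noncomputable def distZ1 (Y : Finset (Finset V)) (t : ℕ) (g : V → V → G) : ℝ :=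
  sInf {r : ℝ | ∃ g' : V → V → G, IsCocycle1 Y g' ∧ r = dist1 Y t g g'}

/-- A `β`-coboundary expander over a (possibly non-abelian) group `G`, for a complex with top
faces of cardinality `t`: in every dimension (0 and 1) below the dimension of the complex,
every cochain which is not a coboundary satisfies `‖δ(f)‖ ≥ β·dist(f,B)`. -/
def CobExpanderNA (Y : Finset (Finset V)) (t : ℕ) (G : Type*) [Group G] (β : ℝ) : Prop :=
  (2 ≤ t → ∀ f : V → G, IsC0 Y f → ¬IsConst0 Y f →
      norm1 Y t (d0 f) ≥ β * distB0 Y t f) ∧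
    (3 ≤ t → ∀ g : V → V → G, IsC1 Y g → ¬IsCoboundary1 Y g →
      norm2 Y t (d1 g) ≥ β * distB1 Y t g)

/-- The links (of all nonempty faces) of `Y` are `β`-coboundary expanders over `G`. -/
def HasCobExpandingLinksNA (Y : Finset (Finset V)) (d : ℕ) (G : Type*) [Group G]
    (β : ℝ) : Prop :=
  ∀ σ ∈ Y, σ.Nonempty → CobExpanderNA (link Y σ) (d + 1 - σ.card) G β

end NonAbelian

end HDX
namespace HDXaux

theorem int_ineq (D1 a : ℕ) (h1 : a = 1 → D1 = 1) : (a : ℤ) - (a * a - a : ℕ) ≤ D1 := by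
  rcases Nat.lt_or_ge a 2 with h | h
  · interval_cases a
    · simp
    · simp [h1]
  · have : 2 * a ≤ a * a := Nat.mul_le_mul_right a h
    omega

theorem L1 {V : Type*} [DecidableEq V] (A : Finset (Finset V)) (σ : Finset V) (m : ℕ) :
    ((σ.powersetCard m).filter (· ∈ A)).card * (σ.card - m) ≤
      ∑ τ ∈ σ.powersetCard (m + 1), ((τ.powersetCard m).filter (· ∈ A)).card := by
  have e1 : ((σ.powersetCard m).filter (· ∈ A)).card * (σ.card - m) =
      (((σ.powersetCard m).filter (· ∈ A)).sigma (fun α => σ \ α)).card := by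
    rw [Finset.card_sigma, ← smul_eq_mul, ← Finset.sum_const]
    refine Finset.sum_congr rfl fun α hα => ?_
    rw [mem_filter, mem_powersetCard] at hα
    rw [Finset.card_sdiff_of_subset hα.1.1, hα.1.2]
  rw [e1, ← Finset.card_sigma]
  refine Finset.card_le_card_of_injOn (fun q => ⟨insert q.2 q.1, q.1⟩) ?_ ?_
  · rintro ⟨α, x⟩ h
    simp only [coe_sigma, Set.mem_sigma_iff, mem_coe, mem_filter, mem_powersetCard, mem_sdiff] at h ⊢
    obtain ⟨⟨⟨h1, h2⟩, h3⟩, h4, h5⟩ := h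
    refine ⟨⟨insert_subset h4 h1, by rw [card_insert_of_notMem h5, h2]⟩, ⟨subset_insert _ _, h2⟩, h3⟩
  · rintro ⟨α, x⟩ h ⟨β, y⟩ h' he
    simp only [coe_sigma, Set.mem_sigma_iff, mem_coe, mem_filter, mem_powersetCard, mem_sdiff] at h h'
    simp only [Sigma.mk.injEq, heq_eq_eq] at he
    obtain ⟨h1, rfl⟩ := he
    have : x ∈ insert y α := h1 ▸ mem_insert_self x α
    rw [mem_insert] at this
    rcases this with rfl | h2
    · rfl
    · exact absurd h2 h.2.2

theorem exists_insert {V : Type*} [DecidableEq V] {ρ τ : Finset V} {m : ℕ} (h : ρ ⊆ τ)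
    (h1 : ρ.card = m) (h2 : τ.card = m + 1) : ∃ u, u ∉ ρ ∧ insert u ρ = τ := by
  have : (τ \ ρ).card = 1 := by rw [Finset.card_sdiff_of_subset h]; omega
  obtain ⟨u, hu⟩ := Finset.card_eq_one.1 this
  have hu' : u ∈ τ \ ρ := by simp [hu]
  refine ⟨u, (mem_sdiff.1 hu').2, ?_⟩
  rw [Finset.insert_eq, ← hu, Finset.sdiff_union_of_subset h]

theorem L2 {V : Type*} [DecidableEq V] (A : Finset (Finset V)) (S : Finset V → Prop)
    [DecidablePred S] (σ : Finset V) (m : ℕ) :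
    ∑ ρ ∈ (σ.powersetCard m).filter S, ((σ \ ρ).filter (fun u => insert u ρ ∈ A)).card =
      ∑ τ ∈ (σ.powersetCard (m+1)).filter (· ∈ A), ((τ.powersetCard m).filter S).card := by
  rw [← Finset.card_sigma, ← Finset.card_sigma]
  refine Finset.card_bij (fun q _ => ⟨insert q.2 q.1, q.1⟩) ?_ ?_ ?_
  · rintro ⟨α, x⟩ h
    simp only [mem_sigma, mem_filter, mem_powersetCard, mem_sdiff] at h ⊢
    obtain ⟨⟨⟨h1, h2⟩, h3⟩, ⟨h4, h5⟩, h6⟩ := h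
    refine ⟨⟨⟨insert_subset h4 h1, by rw [card_insert_of_notMem h5, h2]⟩, h6⟩, ⟨subset_insert _ _, h2⟩, h3⟩
  · rintro ⟨α, x⟩ h ⟨β, y⟩ h' he
    simp only [mem_sigma, mem_filter, mem_powersetCard, mem_sdiff] at h h'
    simp only [Sigma.mk.injEq, heq_eq_eq] at he
    obtain ⟨h1, rfl⟩ := he
    have : x ∈ insert y α := h1 ▸ mem_insert_self x α
    rw [mem_insert] at this
    rcases this with rfl | h2
    · rfl
    · exact absurd h2 h.2.1.2
  · rintro ⟨τ, ρ⟩ h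
    simp only [mem_sigma, mem_filter, mem_powersetCard] at h
    obtain ⟨⟨⟨h1, h2⟩, h3⟩, ⟨h4, h5⟩, h6⟩ := h
    obtain ⟨u, hu, rfl⟩ := exists_insert h4 h5 h2
    refine ⟨⟨ρ, u⟩, ?_, rfl⟩
    simp only [mem_sigma, mem_filter, mem_powersetCard, mem_sdiff]
    exact ⟨⟨⟨h4.trans h1, h5⟩, h6⟩, ⟨h1 (mem_insert_self _ _), hu⟩, h3⟩

theorem L3 {V : Type*} [DecidableEq V] (A : Finset (Finset V)) (σ : Finset V) (m : ℕ) :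
    ∑ τ ∈ σ.powersetCard (m + 2), (((τ.powersetCard (m+1)).filter (· ∈ A)).card *
      ((τ.powersetCard (m+1)).filter (· ∈ A)).card - ((τ.powersetCard (m+1)).filter (· ∈ A)).card) ≤
    ∑ ρ ∈ σ.powersetCard m, (((σ \ ρ).filter (fun u => insert u ρ ∈ A)).card *
      ((σ \ ρ).filter (fun u => insert u ρ ∈ A)).card -
        ((σ \ ρ).filter (fun u => insert u ρ ∈ A)).card) := by
  simp only [← Finset.offDiag_card]
  rw [← Finset.card_sigma, ← Finset.card_sigma]
  refine Finset.card_le_card_of_surjOn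
    (fun q => ⟨insert q.2.1 (insert q.2.2 q.1), (insert q.2.1 q.1, insert q.2.2 q.1)⟩) ?_
  rintro ⟨τ, α, β⟩ h
  simp only [mem_coe, mem_sigma, mem_filter, mem_powersetCard, mem_offDiag] at h
  obtain ⟨⟨h1, h2⟩, ⟨⟨h3, h4⟩, h5⟩, ⟨⟨h6, h7⟩, h8⟩, h9⟩ := h
  have hu := Finset.card_union_add_card_inter α β
  have hle : (α ∪ β).card ≤ m + 2 := h2 ▸ Finset.card_le_card (union_subset h3 h6)
  have hlt : (α ∩ β).card < m + 1 := by
    by_contra hc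
    have e1 : α ∩ β = α := Finset.eq_of_subset_of_card_le inter_subset_left (by omega)
    have e2 : α ∩ β = β := Finset.eq_of_subset_of_card_le inter_subset_right (by omega)
    exact h9 (e1.symm.trans e2)
  have hc : (α ∩ β).card = m := by omega
  obtain ⟨u, hu1, hu2⟩ := exists_insert (inter_subset_left (s₁ := α) (s₂ := β)) hc h4
  obtain ⟨v, hv1, hv2⟩ := exists_insert (inter_subset_right (s₁ := α) (s₂ := β)) hc h7
  have huv : α ∪ β = τ := Finset.eq_of_subset_of_card_le (union_subset h3 h6) (by omega)
  have hua : u ∈ α := hu2 ▸ mem_insert_self _ _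
  have hvb : v ∈ β := hv2 ▸ mem_insert_self _ _
  refine ⟨⟨α ∩ β, (u, v)⟩, ?_, ?_⟩
  · simp only [mem_coe, mem_sigma, mem_filter, mem_powersetCard, mem_offDiag, mem_sdiff, hu2, hv2]
    refine ⟨⟨inter_subset_left.trans (h3.trans h1), hc⟩, ⟨⟨h1 (h3 hua), hu1⟩, h5⟩,
      ⟨⟨h1 (h6 hvb), hv1⟩, h8⟩, ?_⟩
    rintro rfl
    exact h9 (hu2.symm.trans hv2)
  · simp only [hu2, hv2, Sigma.mk.injEq, heq_eq_eq, and_true]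
    rw [← huv]
    ext x
    have := Finset.ext_iff.1 hu2 x
    simp only [mem_insert, mem_inter, mem_union] at this ⊢
    tauto

theorem graph {V : Type*} [Fintype V] (w : V → V → ℝ) (lam : ℝ) (hsym : ∀ u v, w u v = w v u)
    (h : HDX.IsSpectralExpanderW w lam) (hD : ∑ u, ∑ v, w u v = 2)
    (g : V → ℝ) (hg : ∀ u, g u ^ 2 = g u) (p : ℝ) (hp : ∑ u, (∑ v, w u v) * g u = 2 * p) :
    ∑ u, ∑ v, w u v * g u * g v ≤ 2 * p * (lam + (1 - lam) * p) := by
  have h0 := h (fun u => g u - p) (by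
    simp only [mul_sub, Finset.sum_sub_distrib, ← Finset.sum_mul, hp, hD]; ring)
  have hp' : ∑ u, ∑ v, w u v * g u = 2 * p := by
    rw [← hp]; exact Finset.sum_congr rfl fun u _ => (Finset.sum_mul _ _ _).symm
  have hp'' : ∑ u, ∑ v, w u v * g v = 2 * p := by
    rw [← hp', Finset.sum_comm]
    exact Finset.sum_congr rfl fun u _ => Finset.sum_congr rfl fun v _ => by rw [hsym]
  have e1 : ∑ u, ∑ v, w u v * (g u - p) * (g v - p) =
      ∑ u, ∑ v, w u v * g u * g v - 2 * p ^ 2 := by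
    have : ∀ u v, w u v * (g u - p) * (g v - p) =
      w u v * g u * g v - p * (w u v * g u) - p * (w u v * g v) + p ^ 2 * w u v := by
      intros; ring
    simp only [this, Finset.sum_sub_distrib, Finset.sum_add_distrib, ← Finset.mul_sum, hp', hp'', hD]
    ring
  have e2 : ∑ u, (∑ v, w u v) * (g u - p) ^ 2 = 2 * p - 2 * p ^ 2 := by
    have : ∀ u, (∑ v, w u v) * (g u - p) ^ 2 =
      (∑ v, w u v) * g u - 2 * p * ((∑ v, w u v) * g u) + p ^ 2 * (∑ v, w u v) := by
      intro u
      have := hg u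
      linear_combination (∑ v, w u v) * this
    simp only [this, Finset.sum_sub_distrib, Finset.sum_add_distrib, ← Finset.mul_sum, hp, hD]
    ring
  simp only [e1, e2] at h0
  have := (abs_le.1 h0).2
  linarith

theorem edgeWt_eq {V : Type*} [Fintype V] [DecidableEq V] (Y : Finset (Finset V)) (n : ℕ)
    (u v : V) : HDX.edgeWt Y n u v =
      (∑ s ∈ HDX.facesCard Y n, (if u ∈ s then if v ∈ s.erase u then (1:ℝ) else 0 else 0)) /
        (((HDX.facesCard Y n).card : ℝ) * (n.choose 2 : ℝ)) := by
  unfold HDX.edgeWt HDX.wt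
  by_cases huv : u = v
  · subst huv; simp
  · rw [if_pos huv]
    congr 1
    refine Finset.sum_congr rfl fun s _ => ?_
    have : (s.powersetCard 2).filter (· ∈ ({({u, v} : Finset V)} : Finset (Finset V))) =
        if u ∈ s ∧ v ∈ s then {{u, v}} else ∅ := by
      ext x
      split_ifs with hs
      · simp only [mem_filter, mem_powersetCard, mem_singleton]
        constructor
        · exact fun h => h.2
        · rintro rfl
          refine ⟨⟨?_, card_pair huv⟩, rfl⟩
          intro y; simp only [mem_insert, mem_singleton]; rintro (rfl | rfl) <;> tauto
      · simp only [mem_filter, mem_powersetCard, mem_singleton, notMem_empty, iff_false]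
        rintro ⟨⟨h1, -⟩, rfl⟩
        exact hs ⟨h1 (by simp), h1 (by simp)⟩
    rw [this]
    by_cases hu : u ∈ s <;> by_cases hv : v ∈ s <;> simp [hu, hv, Ne.symm huv]

theorem spec {V : Type*} [Fintype V] [DecidableEq V] (Y : Finset (Finset V)) (n : ℕ) (hn : 2 ≤ n)
    (hne : (HDX.facesCard Y n).Nonempty) (lam : ℝ)
    (h : HDX.IsSpectralExpanderW (HDX.edgeWt Y n) lam) (B : Finset V) (p : ℝ)
    (hp : p = (∑ s ∈ HDX.facesCard Y n, ((s ∩ B).card : ℝ)) / ((HDX.facesCard Y n).card * n)) :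
    ∑ s ∈ HDX.facesCard Y n, (((s ∩ B).card * (s ∩ B).card - (s ∩ B).card : ℕ) : ℝ) ≤
      ((n : ℝ) - 1) * (lam + (1 - lam) * p) * ∑ s ∈ HDX.facesCard Y n, ((s ∩ B).card : ℝ) := by
  set F := HDX.facesCard Y n with hF
  have hFc : ∀ s ∈ F, s.card = n := fun s hs => (mem_filter.1 hs).2
  have hN : (0:ℝ) < F.card := by exact_mod_cast hne.card_pos
  have hn' : (2:ℝ) ≤ n := by exact_mod_cast hn
  have hch : (n.choose 2 : ℝ) = n * (n - 1) / 2 := by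
    rw [Nat.cast_choose_two]
  set Z : ℝ := F.card * (n.choose 2 : ℝ) with hZ
  have hZ0 : 0 < Z := by
    rw [hZ, hch]; have : (0:ℝ) < n - 1 := by linarith
    positivity
  have hdeg : ∀ u, ∑ v, HDX.edgeWt Y n u v =
      (∑ s ∈ F, if u ∈ s then ((n:ℝ) - 1) else 0) / Z := by
    intro u
    simp only [edgeWt_eq]
    rw [← Finset.sum_div, Finset.sum_comm]
    congr 1
    refine Finset.sum_congr rfl fun s hs => ?_
    split_ifs with hu
    · rw [Finset.sum_ite_mem, univ_inter, sum_const, card_erase_of_mem hu, hFc s hs, nsmul_eq_mul, mul_one]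
      rw [Nat.cast_sub (by omega)]; simp
    · simp
  have hD : ∑ u, ∑ v, HDX.edgeWt Y n u v = 2 := by
    simp only [hdeg]
    rw [← Finset.sum_div, Finset.sum_comm, div_eq_iff hZ0.ne']
    rw [Finset.sum_congr rfl (g := fun _ => (n:ℝ) * (n - 1))]
    · rw [sum_const, nsmul_eq_mul, hZ, hch]; ring
    · intro s hs
      rw [Finset.sum_ite_mem, univ_inter, sum_const, hFc s hs, nsmul_eq_mul]
  have hpN : ∑ s ∈ F, ((s ∩ B).card : ℝ) = p * (F.card * n) := by
    rw [hp, div_mul_cancel₀]; positivity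
  have hB : ∑ u, (∑ v, HDX.edgeWt Y n u v) * (if u ∈ B then (1:ℝ) else 0) = 2 * p := by
    simp only [hdeg]
    have : ∀ u, (∑ s ∈ F, if u ∈ s then ((n:ℝ) - 1) else 0) / Z * (if u ∈ B then (1:ℝ) else 0) =
        (∑ s ∈ F, if u ∈ s ∩ B then ((n:ℝ) - 1) else 0) / Z := by
      intro u
      by_cases hu : u ∈ B <;> simp [hu]
    simp only [this]
    rw [← Finset.sum_div, Finset.sum_comm, div_eq_iff hZ0.ne']
    simp only [Finset.sum_ite_mem, univ_inter, sum_const, nsmul_eq_mul]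
    rw [← Finset.sum_mul, hpN, hZ, hch]; ring
  have key := graph _ lam (fun u v => by
    unfold HDX.edgeWt; simp only [ne_comm (a := u), Finset.pair_comm u]) h hD _
    (fun u => by split_ifs <;> norm_num) p hB
  have hE : ∑ u, ∑ v, HDX.edgeWt Y n u v * (if u ∈ B then (1:ℝ) else 0) * (if v ∈ B then (1:ℝ) else 0)
      = (∑ s ∈ F, (((s ∩ B).card * (s ∩ B).card - (s ∩ B).card : ℕ) : ℝ)) / Z := by
    have : ∀ u v, HDX.edgeWt Y n u v * (if u ∈ B then (1:ℝ) else 0) * (if v ∈ B then (1:ℝ) else 0) =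
      (∑ s ∈ F, if u ∈ s ∩ B then if v ∈ (s ∩ B).erase u then (1:ℝ) else 0 else 0) / Z := by
      intro u v
      rw [edgeWt_eq]
      by_cases hu : u ∈ B <;> by_cases hv : v ∈ B <;> simp [hu, hv, hF, hZ]
    simp only [this]
    simp only [← Finset.sum_div]
    congr 1
    rw [Finset.sum_congr rfl (fun u _ => Finset.sum_comm), Finset.sum_comm]
    refine Finset.sum_congr rfl fun s hs => ?_
    have : ∀ u, ∑ v, (if u ∈ s ∩ B then if v ∈ (s ∩ B).erase u then (1:ℝ) else 0 else 0) =
        if u ∈ s ∩ B then (((s ∩ B).card - 1 : ℕ) : ℝ) else 0 := by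
      intro u
      split_ifs with hu
      · rw [Finset.sum_ite_mem, univ_inter, sum_const, card_erase_of_mem hu, nsmul_eq_mul, mul_one]
      · simp
    simp only [this]
    rw [Finset.sum_ite_mem, univ_inter, sum_const, nsmul_eq_mul, ← Nat.cast_mul, Nat.mul_sub, mul_one]
  rw [hE, div_le_iff₀ hZ0] at key
  refine key.trans (le_of_eq ?_)
  rw [hpN, hZ, hch]; ring

end HDXaux

namespace HDXaux

theorem link_faces {V : Type*} [Fintype V] [DecidableEq V] (X : Finset (Finset V)) (t k : ℕ)
    (hkt : k ≤ t) (ρ : Finset V) (hρ : ρ.card = k) :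
    HDX.facesCard (HDX.link X ρ) (t - k) =
      ((HDX.facesCard X t).filter (fun σ => ρ ⊆ σ)).image (fun σ => σ \ ρ) := by
  ext s
  simp only [HDX.facesCard, HDX.link, HDX.localize, mem_filter, mem_image]
  constructor
  · rintro ⟨⟨σ, ⟨h1, h2⟩, rfl⟩, h3⟩
    rw [Finset.card_sdiff_of_subset h2] at h3
    have := Finset.card_le_card h2
    exact ⟨σ, ⟨⟨h1, by omega⟩, h2⟩, rfl⟩
  · rintro ⟨σ, ⟨⟨h1, h3⟩, h2⟩, rfl⟩
    refine ⟨⟨σ, ⟨h1, h2⟩, rfl⟩, ?_⟩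
    rw [Finset.card_sdiff_of_subset h2]; omega

theorem link_sum {V : Type*} [Fintype V] [DecidableEq V] (X : Finset (Finset V)) (t k : ℕ)
    (hkt : k ≤ t) (ρ : Finset V) (hρ : ρ.card = k) (g : Finset V → ℝ) :
    ∑ s ∈ HDX.facesCard (HDX.link X ρ) (t - k), g s =
      ∑ σ ∈ (HDX.facesCard X t).filter (fun σ => ρ ⊆ σ), g (σ \ ρ) := by
  rw [link_faces X t k hkt ρ hρ, Finset.sum_image]
  intro σ h σ' h' he
  have h1 := (mem_filter.1 h).2
  have h2 := (mem_filter.1 h').2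
  have he : σ \ ρ = σ' \ ρ := he
  rw [← Finset.sdiff_union_of_subset h1, he, Finset.sdiff_union_of_subset h2]

theorem pow1 {V : Type*} [Fintype V] [DecidableEq V] (A : Finset (Finset V)) (ρ s : Finset V)
    (hs : Disjoint s ρ) :
    ((s.powersetCard 1).filter (· ∈ HDX.localize A ρ)).card =
      (s ∩ univ.filter (fun u => insert u ρ ∈ A)).card := by
  have : (s.powersetCard 1).filter (· ∈ HDX.localize A ρ) =
      (s ∩ univ.filter (fun u => insert u ρ ∈ A)).image (fun u => {u}) := by
    ext x
    simp only [HDX.localize, mem_filter, mem_powersetCard, mem_image, mem_inter, mem_univ, true_and]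
    constructor
    · rintro ⟨⟨h1, h2⟩, τ, ⟨h3, h4⟩, h5⟩
      obtain ⟨u, rfl⟩ := Finset.card_eq_one.1 h2
      refine ⟨u, ⟨h1 (by simp), ?_⟩, rfl⟩
      rw [Finset.insert_eq, ← h5, Finset.sdiff_union_of_subset h4]; exact h3
    · rintro ⟨u, ⟨h1, h2⟩, rfl⟩
      refine ⟨⟨by simpa using h1, by simp⟩, insert u ρ, ⟨h2, subset_insert _ _⟩, ?_⟩
      have hu : u ∉ ρ := Finset.disjoint_left.1 hs h1
      ext y
      simp only [mem_sdiff, mem_insert, mem_singleton]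
      constructor
      · tauto
      · rintro rfl; tauto
  rw [this, Finset.card_image_of_injective _ Finset.singleton_injective]

/-- number of vertices extending `ρ` inside `σ` to a member of `A` -/
noncomputable def bb {V : Type*} [DecidableEq V] (A : Finset (Finset V)) (ρ σ : Finset V) : ℕ :=
  ((σ \ ρ).filter (fun u => insert u ρ ∈ A)).card

theorem local_ineq {V : Type*} [Fintype V] [DecidableEq V]
    (X : Finset (Finset V)) (d : ℕ) (lam : ℝ) (hXd : HDX.IsPureDim X d)
    (hlse : HDX.IsLocalSpectralExpander X d lam) (k : ℕ) (hk : k + 1 ≤ d)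
    (A : Finset (Finset V)) (ρ : Finset V) (hρ : ρ ∈ HDX.facesCard X k) :
    ∑ σ ∈ (HDX.facesCard X (d+1)).filter (fun σ => ρ ⊆ σ), ((bb A ρ σ * bb A ρ σ - bb A ρ σ : ℕ) : ℝ)
      ≤ ((d:ℝ) - k) * (lam + (1 - lam) * HDX.locWt X (d + 1) A (k + 1) ρ) *
        ∑ σ ∈ (HDX.facesCard X (d+1)).filter (fun σ => ρ ⊆ σ), (bb A ρ σ : ℝ) := by
  obtain ⟨hρX, hρc⟩ := mem_filter.1 hρ
  have hlf := link_faces X (d+1) k (by omega) ρ hρc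
  have hls := link_sum X (d+1) k (by omega) ρ hρc
  have hne : (HDX.facesCard (HDX.link X ρ) (d + 1 - k)).Nonempty := by
    obtain ⟨τ, h1, h2, h3⟩ := hXd.2.2 ρ hρX
    rw [hlf]
    refine Finset.Nonempty.image ⟨τ, ?_⟩ _
    simp [HDX.facesCard, h1, h2, h3]
  have hb : ∀ σ, bb A ρ σ = ((σ \ ρ) ∩ univ.filter (fun u => insert u ρ ∈ A)).card := by
    intro σ; unfold bb; congr 1; ext u; simp
  have hsp := hlse ρ hρX (by omega)
  rw [hρc] at hsp
  have := spec (HDX.link X ρ) (d + 1 - k) (by omega) hne lam hsp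
    (univ.filter (fun u => insert u ρ ∈ A)) (HDX.locWt X (d + 1) A (k + 1) ρ) (by
      unfold HDX.locWt HDX.wt
      rw [hρc, Nat.add_sub_cancel_left, Nat.choose_one_right]
      congr 1
      refine Finset.sum_congr rfl fun s hs => ?_
      rw [pow1]
      rw [hlf, mem_image] at hs
      obtain ⟨σ, -, rfl⟩ := hs
      exact Finset.sdiff_disjoint)
  rw [hls, hls] at this
  simp only [hb]
  rw [Nat.cast_sub (by omega)] at this
  push_cast at this ⊢
  convert this using 3
  ring

theorem swap {V : Type*} [Fintype V] [DecidableEq V] (X : Finset (Finset V)) (t k : ℕ)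
    (hX : HDX.IsComplex X) (g : Finset V → Finset V → ℝ) (S : Finset V → Prop) :
    ∑ σ ∈ HDX.facesCard X t, ∑ ρ ∈ (σ.powersetCard k).filter S, g ρ σ =
      ∑ ρ ∈ (HDX.facesCard X k).filter S,
        ∑ σ ∈ (HDX.facesCard X t).filter (fun σ => ρ ⊆ σ), g ρ σ := by
  apply Finset.sum_comm'
  intro σ ρ
  simp only [HDX.facesCard, mem_filter, mem_powersetCard]
  constructor
  · rintro ⟨⟨h1, h2⟩, ⟨h3, h4⟩, h5⟩
    exact ⟨⟨⟨h1, h2⟩, h3⟩, ⟨hX _ h1 _ h3, h4⟩, h5⟩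
  · tauto

theorem delta_bound {V : Type*} [Fintype V] [DecidableEq V]
    (X : Finset (Finset V)) (hX : HDX.IsComplex X) (k : ℕ) (A : Finset (Finset V)) (σ : Finset V)
    (hσ : σ ∈ X) :
    ((((σ.powersetCard (k+1)).filter (· ∈ A)).card * (σ.card - (k+1)) : ℕ) : ℝ) -
      ∑ ρ ∈ σ.powersetCard k, ((bb A ρ σ * bb A ρ σ - bb A ρ σ : ℕ) : ℝ) ≤
      (((σ.powersetCard (k+2)).filter (· ∈ HDX.delta1 X (k+1) A)).card : ℝ) := by
  have h1 := L1 A σ (k+1)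
  have h3 := L3 A σ k
  have h4 : ∑ τ ∈ σ.powersetCard (k+2), (((((τ.powersetCard (k+1)).filter (· ∈ A)).card : ℕ) : ℤ) -
      ((((τ.powersetCard (k+1)).filter (· ∈ A)).card *
      ((τ.powersetCard (k+1)).filter (· ∈ A)).card - ((τ.powersetCard (k+1)).filter (· ∈ A)).card : ℕ) : ℤ))
      ≤ ∑ τ ∈ σ.powersetCard (k+2), ((if τ ∈ HDX.delta1 X (k+1) A then 1 else 0 : ℕ) : ℤ) := by
    refine Finset.sum_le_sum fun τ hτ => int_ineq _ _ ?_
    intro h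
    rw [mem_powersetCard] at hτ
    rw [if_pos]
    simp only [HDX.delta1, HDX.facesCard, mem_filter]
    exact ⟨⟨hX _ hσ _ hτ.1, hτ.2⟩, h⟩
  rw [Finset.sum_sub_distrib, ← Nat.cast_sum, ← Nat.cast_sum, ← Nat.cast_sum, ← Finset.card_filter] at h4
  unfold bb
  rw [← Nat.cast_sum]
  have h5 : ((((σ.powersetCard (k+1)).filter (· ∈ A)).card * (σ.card - (k+1)) : ℕ) : ℤ) -
      ((∑ ρ ∈ σ.powersetCard k, (((σ \ ρ).filter (fun u => insert u ρ ∈ A)).card *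
      ((σ \ ρ).filter (fun u => insert u ρ ∈ A)).card -
        ((σ \ ρ).filter (fun u => insert u ρ ∈ A)).card) : ℕ) : ℤ) ≤
      (((σ.powersetCard (k+2)).filter (· ∈ HDX.delta1 X (k+1) A)).card : ℤ) := by
    have h1' := Int.ofNat_le.2 h1
    have h3' := Int.ofNat_le.2 h3
    linarith
  exact_mod_cast h5

end HDXaux

set_option maxHeartbeats 2000000


/-- in a `d`-dimensional `λ`-local spectral expander, if `A ⊆ X(k)`
(`0 ≤ k ≤ d-1`) satisfies `‖A_σ‖ ≤ 1-α` for every `σ ∈ X(k-1)` then, with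
`S_{k-1} = {σ ∈ X(k-1) : ‖A_σ‖ ≤ η^(1/3)}`,
`‖δ₁(A)‖ ≥ (k+1)(k+2)((1-λ)(1-α-η^(1/3))‖(A,S_{k-1})‖ - (k/(k+1) - (1-λ)α)‖A‖)`. -/
theorem stmt11 {V : Type*} [Fintype V] [DecidableEq V]
    (X : Finset (Finset V)) (d : ℕ) (lam η α : ℝ)
    (hX : HDX.IsComplex X) (hXd : HDX.IsPureDim X d)
    (hlse : HDX.IsLocalSpectralExpander X d lam)
    (hη0 : 0 < η) (hη1 : η < 1) (hα0 : 0 < α) (hα1 : α < 1)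
    (k : ℕ) (hk : k + 1 ≤ d)
    (A : Finset (Finset V)) (hA : A ⊆ HDX.facesCard X (k + 1))
    (hloc : ∀ σ ∈ HDX.facesCard X k, HDX.locWt X (d + 1) A (k + 1) σ ≤ 1 - α) :
    HDX.wt X (d + 1) (k + 2) (HDX.delta1 X (k + 1) A) ≥
      ((k : ℝ) + 1) * ((k : ℝ) + 2) *
        ((1 - lam) * (1 - α - η ^ ((1 : ℝ) / 3)) *
            HDX.mwt X (d + 1) (k + 1) k A
              (HDX.nonlocalS X (d + 1) k A (η ^ ((1 : ℝ) / 3))) -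
          ((k : ℝ) / ((k : ℝ) + 1) - (1 - lam) * α) * HDX.wt X (d + 1) (k + 1) A) := by
  have hh0 : 0 < η ^ ((1 : ℝ) / 3) := Real.rpow_pos_of_pos hη0 _
  have hh1 : η ^ ((1 : ℝ) / 3) < 1 := Real.rpow_lt_one hη0.le hη1 (by norm_num)
  generalize η ^ ((1 : ℝ) / 3) = h at hh0 hh1
  set T := HDX.facesCard X (d+1) with hT
  have hTm : ∀ σ ∈ T, σ ∈ X ∧ σ.card = d + 1 := fun σ hs => mem_filter.1 hs
  have hTne : T.Nonempty := by
    obtain ⟨σ, hs⟩ := hXd.1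
    obtain ⟨τ, h1, -, h2⟩ := hXd.2.2 σ hs
    exact ⟨τ, mem_filter.2 ⟨h1, h2⟩⟩
  set P : ℝ := ∑ σ ∈ T, (((σ.powersetCard (k+1)).filter (· ∈ A)).card : ℝ) with hP
  set S := HDX.nonlocalS X (d + 1) k A h with hS
  set Q : ℝ := ∑ σ ∈ T, ∑ τ ∈ (σ.powersetCard (k+1)).filter (· ∈ A),
      (((τ.powersetCard k).filter (· ∈ S)).card : ℝ) with hQ
  set D : ℝ := ∑ σ ∈ T, (((σ.powersetCard (k+2)).filter (· ∈ HDX.delta1 X (k+1) A)).card : ℝ) with hD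
  let c : Finset V → ℝ := fun ρ => ∑ σ ∈ T.filter (fun σ => ρ ⊆ σ), (HDXaux.bb A ρ σ : ℝ)
  have hc0 : ∀ ρ, 0 ≤ c ρ := fun ρ => Finset.sum_nonneg fun _ _ => Nat.cast_nonneg _
  have hL2 : ∀ S' : Finset V → Prop, ∑ ρ ∈ (HDX.facesCard X k).filter S', c ρ =
      ∑ σ ∈ T, ∑ τ ∈ (σ.powersetCard (k+1)).filter (· ∈ A),
      (((τ.powersetCard k).filter S').card : ℝ) := by
    intro S'
    rw [← HDXaux.swap X (d+1) k hX (fun ρ σ => (HDXaux.bb A ρ σ : ℝ)) S']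
    refine Finset.sum_congr rfl fun σ _ => ?_
    have := HDXaux.L2 A S' σ k
    unfold HDXaux.bb
    exact_mod_cast this
  have hall : ∑ ρ ∈ HDX.facesCard X k, c ρ = (k+1) * P := by
    have := hL2 (fun _ => True)
    rw [Finset.filter_true] at this
    rw [this, hP, Finset.mul_sum]
    refine Finset.sum_congr rfl fun σ _ => ?_
    rw [Finset.sum_congr rfl (g := fun _ => (k:ℝ) + 1), sum_const, nsmul_eq_mul, mul_comm]
    intro τ hτ
    have hc := (mem_powersetCard.1 (mem_filter.1 hτ).1).2
    rw [Finset.filter_true, card_powersetCard, hc, Nat.choose_succ_self_right]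
    push_cast; rfl
  have hSs : ∑ ρ ∈ (HDX.facesCard X k).filter (· ∈ S), c ρ = Q := by
    rw [hQ]; convert hL2 (· ∈ S)
  have hP0 : 0 ≤ P := Finset.sum_nonneg fun _ _ => Nat.cast_nonneg _
  have hQ0 : 0 ≤ Q := Finset.sum_nonneg fun _ _ => Finset.sum_nonneg fun _ _ => Nat.cast_nonneg _
  have hQP : Q ≤ (k+1) * P := by
    rw [← hall, ← hSs]
    exact Finset.sum_le_sum_of_subset_of_nonneg (filter_subset _ _) fun _ _ _ => hc0 _
  have hD0 : 0 ≤ D := Finset.sum_nonneg fun _ _ => Nat.cast_nonneg _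
  have hN : (0:ℝ) < T.card := by exact_mod_cast hTne.card_pos
  have hCn : (0:ℝ) < ((d+1).choose (k+1) : ℝ) := by exact_mod_cast Nat.choose_pos (by omega)
  have hn : (0:ℝ) < (d:ℝ) - k := by
    have : ((k + 1 : ℕ) : ℝ) ≤ d := by exact_mod_cast hk
    push_cast at this; linarith
  have hk0 : (0:ℝ) < (k:ℝ) + 1 := by positivity
  have hCC : ((d+1).choose (k+2) : ℝ) = ((d+1).choose (k+1) : ℝ) * ((d:ℝ) - k) / (k + 2) := by
    rw [eq_div_iff (by positivity)]
    have := Nat.choose_succ_right_eq (d+1) (k+1)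
    have h2 : d + 1 - (k + 1) = d - k := by omega
    rw [h2] at this
    have h3 : (((d+1).choose (k+1+1) * (k+1+1) : ℕ) : ℝ) = (((d+1).choose (k+1) * (d - k) : ℕ) : ℝ) := by
      rw [this]
    rw [Nat.cast_mul, Nat.cast_mul, Nat.cast_sub (by omega : k ≤ d)] at h3
    push_cast at h3
    linarith
  -- the core inequality
  have core : ((d:ℝ) - k) * ((1 - lam) * ((1 - α - h) * Q + α * ((k+1) * P)) - k * P) ≤ D := by
    by_cases hl : lam ≤ 1
    · have hb : ((d:ℝ) - k) * P - ∑ ρ ∈ HDX.facesCard X k,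
          ∑ σ ∈ T.filter (fun σ => ρ ⊆ σ),
            ((HDXaux.bb A ρ σ * HDXaux.bb A ρ σ - HDXaux.bb A ρ σ : ℕ) : ℝ) ≤ D := by
        have hsw := HDXaux.swap X (d+1) k hX (fun ρ σ =>
          ((HDXaux.bb A ρ σ * HDXaux.bb A ρ σ - HDXaux.bb A ρ σ : ℕ) : ℝ)) (fun _ => True)
        simp only [Finset.filter_true] at hsw
        rw [← hsw, hP, Finset.mul_sum, ← Finset.sum_sub_distrib]
        refine Finset.sum_le_sum fun σ hs => ?_
        have := HDXaux.delta_bound X hX k A σ (hTm σ hs).1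
        rw [(hTm σ hs).2, show d + 1 - (k+1) = d - k by omega, Nat.cast_mul,
          Nat.cast_sub (by omega : k ≤ d), mul_comm] at this
        exact this
      have hE : ∑ ρ ∈ HDX.facesCard X k, ∑ σ ∈ T.filter (fun σ => ρ ⊆ σ),
            ((HDXaux.bb A ρ σ * HDXaux.bb A ρ σ - HDXaux.bb A ρ σ : ℕ) : ℝ) ≤
          ∑ ρ ∈ HDX.facesCard X k, ((d:ℝ) - k) * ((lam + (1 - lam) * (1 - α)) * c ρ -
            (1 - lam) * (1 - α - h) * (if ρ ∈ S then c ρ else 0)) := by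
        refine Finset.sum_le_sum fun ρ hρ => ?_
        refine (HDXaux.local_ineq X d lam hXd hlse k hk A ρ hρ).trans ?_
        change _ * c ρ ≤ _
        rw [mul_assoc]
        refine mul_le_mul_of_nonneg_left ?_ hn.le
        have hl' : 0 ≤ (1 - lam) * c ρ := mul_nonneg (by linarith) (hc0 ρ)
        split_ifs with hs
        · have := mul_le_mul_of_nonneg_left (mem_filter.1 hs).2 hl'
          linarith
        · have := mul_le_mul_of_nonneg_left (hloc ρ hρ) hl'
          linarith
      rw [← Finset.mul_sum, Finset.sum_sub_distrib, ← Finset.mul_sum, ← Finset.mul_sum,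
        ← Finset.sum_filter, hall, hSs] at hE
      have : ((d:ℝ) - k) * ((1 - lam) * ((1 - α - h) * Q + α * ((k+1) * P)) - k * P) =
        ((d:ℝ) - k) * P - ((d:ℝ) - k) * ((lam + (1 - lam) * (1 - α)) * ((k+1) * P) -
            (1 - lam) * (1 - α - h) * Q) := by ring
      rw [this]; linarith
    · push Not at hl
      have h1 : 0 ≤ (1 - α - h) * Q + α * ((k+1) * P) := by
        have e1 := mul_nonneg hα0.le (sub_nonneg.2 hQP)
        have e2 := mul_nonneg (sub_nonneg.2 hh1.le) hQ0
        linarith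
      have h2 : (1 - lam) * ((1 - α - h) * Q + α * ((k+1) * P)) ≤ 0 :=
        mul_nonpos_of_nonpos_of_nonneg (by linarith) h1
      have h3 : 0 ≤ (k:ℝ) * P := mul_nonneg (Nat.cast_nonneg k) hP0
      exact (mul_nonpos_of_nonneg_of_nonpos hn.le (by linarith)).trans hD0
  have hw1 : HDX.wt X (d + 1) (k + 2) (HDX.delta1 X (k + 1) A) =
      D / (T.card * ((d+1).choose (k+2) : ℝ)) := rfl
  have hw2 : HDX.wt X (d + 1) (k + 1) A = P / (T.card * ((d+1).choose (k+1) : ℝ)) := rfl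
  have hw3 : HDX.mwt X (d + 1) (k + 1) k A S =
      Q / (T.card * ((d+1).choose (k+1) : ℝ) * ((k+1).choose k : ℝ)) := rfl
  rw [hw1, hw2, hw3, hCC, Nat.choose_succ_self_right, ge_iff_le, le_div_iff₀ (by positivity)]
  refine le_trans (le_of_eq ?_) core
  clear_value P Q D T S
  push_cast
  field_simp
  ring
end

section
/- Let X be a d-dimensional λ-local spectral expander and 0 < η < 1. For any A ⊆ X(k) with 1 ≤ k ≤ d−1, let S_{k−1} = {σ ∈ X(k−1) : ‖A_σ‖ ≤ η^{1/3}}, S_{k−2} = {σ ∈ X(k−2) : ‖A_σ‖ ≤ η}, and let Υ be the set of k-faces σ ∈ A that contain two (k−1)-faces τ, τ' ∈ X(k−1)∖S_{k−1} with τ∩τ' ∈ S_{k−2}. Then ‖Υ‖ ≤ C(k+1,2)·(η^{1/3} + λ·η^{−1/3})·‖A‖. -/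
/- Common framework: weighted simplicial complexes, links, localizations,
   local spectral expansion, cochains, coboundaries, minimality, etc. -/

open Finset

open scoped Classical

set_option linter.unusedSectionVars false

namespace HDXP
open HDX

variable {V : Type*} [Fintype V] [DecidableEq V]

noncomputable def nn (Y : Finset (Finset V)) (t : ℕ) (s : Finset V) : ℝ :=
  (((facesCard Y t).filter fun T => s ⊆ T).card : ℝ)

lemma nn_nonneg (Y : Finset (Finset V)) (t : ℕ) (s : Finset V) : 0 ≤ nn Y t s := by
  unfold nn; positivity

lemma nn_eq_sum (Y : Finset (Finset V)) (t : ℕ) (s : Finset V) :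
    nn Y t s = ∑ T ∈ facesCard Y t, if s ⊆ T then (1 : ℝ) else 0 := by
  unfold nn; rw [Finset.card_filter]; push_cast; rfl

lemma nn_empty (Y : Finset (Finset V)) (t : ℕ) :
    nn Y t ∅ = ((facesCard Y t).card : ℝ) := by
  unfold nn; simp

lemma wt_eq (Y : Finset (Finset V)) (t m : ℕ) (A : Finset (Finset V))
    (hA : ∀ s ∈ A, s.card = m) :
    wt Y t m A = (∑ s ∈ A, nn Y t s) / (nn Y t ∅ * (t.choose m : ℝ)) := by
  unfold wt
  rw [nn_empty]
  congr 1
  simp_rw [nn_eq_sum]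
  rw [Finset.sum_comm]
  refine Finset.sum_congr rfl fun T _ => ?_
  have : (T.powersetCard m).filter (· ∈ A) = A.filter (fun s => s ⊆ T) := by
    ext s
    simp only [Finset.mem_filter, Finset.mem_powersetCard]
    constructor
    · rintro ⟨⟨h1, _⟩, h2⟩; exact ⟨h2, h1⟩
    · rintro ⟨h1, h2⟩; exact ⟨⟨h2, hA s h1⟩, h1⟩
  rw [this, Finset.card_filter]; push_cast; rfl

lemma nn_link (X : Finset (Finset V)) (t : ℕ) (ρ s : Finset V) (hρ : ρ.card ≤ t) :
    nn (link X ρ) (t - ρ.card) s = if Disjoint s ρ then nn X t (ρ ∪ s) else 0 := by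
  split_ifs with h
  · unfold nn
    have : (facesCard (link X ρ) (t - ρ.card)).filter (fun T => s ⊆ T) =
        ((facesCard X t).filter fun T => ρ ∪ s ⊆ T).image fun T => T \ ρ := by
      ext T
      simp only [facesCard, link, localize, Finset.mem_filter, Finset.mem_image]
      constructor
      · rintro ⟨⟨⟨T', ⟨h1, h2⟩, rfl⟩, h3⟩, h4⟩
        refine ⟨T', ⟨⟨h1, ?_⟩, ?_⟩, rfl⟩
        · rw [Finset.card_sdiff_of_subset h2] at h3
          have := Finset.card_le_card h2
          omega
        · exact Finset.union_subset h2 (h4.trans Finset.sdiff_subset)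
      · rintro ⟨T', ⟨⟨h1, h2⟩, h3⟩, rfl⟩
        have h5 : ρ ⊆ T' := Finset.union_subset_left h3
        refine ⟨⟨⟨T', ⟨h1, h5⟩, rfl⟩, ?_⟩, ?_⟩
        · rw [Finset.card_sdiff_of_subset h5, h2]
        · exact Finset.subset_sdiff.2 ⟨Finset.union_subset_right h3, h⟩
    rw [this, Finset.card_image_of_injOn]
    intro a ha b hb hab
    simp only [Finset.coe_filter, Set.mem_ofPred_eq] at ha hb
    have ha' := Finset.union_subset_left ha.2
    have hb' := Finset.union_subset_left hb.2
    simp only at hab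
    rw [← Finset.sdiff_union_of_subset ha', hab, Finset.sdiff_union_of_subset hb']
  · unfold nn
    rw [Finset.filter_eq_empty_iff.2]
    · simp
    · intro T hT hs
      simp only [facesCard, link, localize, Finset.mem_filter, Finset.mem_image] at hT
      obtain ⟨⟨T', ⟨h1, h2⟩, rfl⟩, h3⟩ := hT
      exact h (Finset.subset_sdiff.1 hs).2

noncomputable def aa (X : Finset (Finset V)) (t : ℕ) (A : Finset (Finset V))
    (ρ : Finset V) : ℝ := ∑ σ ∈ A.filter (fun σ => ρ ⊆ σ), nn X t σ

lemma locWt_eq (X : Finset (Finset V)) (t m : ℕ) (A : Finset (Finset V)) (ρ : Finset V)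
    (hA : ∀ s ∈ A, s.card = m) (hρ : ρ.card ≤ t) :
    locWt X t A m ρ = aa X t A ρ / (nn X t ρ * ((t - ρ.card).choose (m - ρ.card) : ℝ)) := by
  unfold locWt
  rw [wt_eq]
  · congr 1
    · unfold localize
      rw [Finset.sum_image]
      · unfold aa
        refine Finset.sum_congr rfl fun σ hσ => ?_
        rw [nn_link _ _ _ _ hρ, if_pos Finset.sdiff_disjoint,
          Finset.union_sdiff_of_subset (Finset.mem_filter.1 hσ).2]
      · intro a ha b hb hab
        simp only [Finset.coe_filter, Set.mem_ofPred_eq] at ha hb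
        simp only at hab
        rw [← Finset.sdiff_union_of_subset ha.2, hab, Finset.sdiff_union_of_subset hb.2]
    · rw [nn_link _ _ _ _ hρ]; simp
  · intro s hs
    simp only [localize, Finset.mem_image, Finset.mem_filter] at hs
    obtain ⟨σ, ⟨h1, h2⟩, rfl⟩ := hs
    rw [Finset.card_sdiff_of_subset h2, hA σ h1]

noncomputable def qq (X : Finset (Finset V)) (t : ℕ) (ρ : Finset V) (u v : V) : ℝ :=
  if u ≠ v ∧ u ∉ ρ ∧ v ∉ ρ then nn X t (insert u (insert v ρ)) else 0

noncomputable def pp (X : Finset (Finset V)) (t : ℕ) (ρ : Finset V) (u : V) : ℝ :=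
  if u ∉ ρ then nn X t (insert u ρ) else 0

lemma pp_nonneg (X : Finset (Finset V)) (t : ℕ) (ρ : Finset V) (u : V) :
    0 ≤ pp X t ρ u := by
  unfold pp; split_ifs <;> simp [nn_nonneg]

lemma qq_symm (X : Finset (Finset V)) (t : ℕ) (ρ : Finset V) (u v : V) :
    qq X t ρ u v = qq X t ρ v u := by
  unfold qq
  rw [Finset.insert_comm]
  congr 1
  simp only [eq_iff_iff]; tauto

lemma edgeWt_eq (X : Finset (Finset V)) (t : ℕ) (ρ : Finset V) (hρ : ρ.card ≤ t) (u v : V) :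
    edgeWt (link X ρ) (t - ρ.card) u v =
      qq X t ρ u v / (nn X t ρ * ((t - ρ.card).choose 2 : ℝ)) := by
  unfold edgeWt qq
  by_cases huv : u = v
  · simp [huv]
  · rw [if_pos huv, wt_eq]
    · rw [Finset.sum_singleton, nn_link _ _ _ _ hρ, nn_link _ _ _ _ hρ]
      congr 1
      · have e : ρ ∪ {u, v} = insert u (insert v ρ) := by
          ext x; simp
        rw [e]
        simp [huv]
      · simp
    · intro s hs
      rw [Finset.mem_singleton.1 hs, Finset.card_pair huv]

lemma sum_pp (X : Finset (Finset V)) (t : ℕ) (ρ : Finset V) (hρ : ρ.card ≤ t) :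
    ∑ u, pp X t ρ u = ((t - ρ.card : ℕ) : ℝ) * nn X t ρ := by
  unfold pp
  have : ∀ u, (if u ∉ ρ then nn X t (insert u ρ) else 0) =
      ∑ T ∈ facesCard X t, if u ∈ T \ ρ ∧ ρ ⊆ T then (1 : ℝ) else 0 := by
    intro u
    by_cases h : u ∉ ρ
    · rw [if_pos h, nn_eq_sum]
      refine Finset.sum_congr rfl fun T _ => ?_
      congr 1
      simp [Finset.insert_subset_iff, h]
    · rw [if_neg h]; symm; apply Finset.sum_eq_zero; intro T _
      rw [if_neg]; simp at h; simp [h]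
  simp_rw [this]
  rw [Finset.sum_comm, nn_eq_sum, Finset.mul_sum]
  refine Finset.sum_congr rfl fun T hT => ?_
  by_cases h : ρ ⊆ T
  · simp only [h, and_true, if_true, mul_one]
    rw [← Finset.sum_filter, Finset.filter_mem_eq_inter, Finset.univ_inter]
    simp only [facesCard, Finset.mem_filter] at hT
    simp [Finset.card_sdiff_of_subset h, hT.2]
  · simp [h]

lemma sum_qq (X : Finset (Finset V)) (t : ℕ) (ρ : Finset V) (hρ : ρ.card + 1 ≤ t) (u : V) :
    ∑ v, qq X t ρ u v = ((t - ρ.card - 1 : ℕ) : ℝ) * pp X t ρ u := by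
  by_cases h : u ∈ ρ
  · simp [qq, pp, h]
  · have e : ∀ v, qq X t ρ u v = pp X t (insert u ρ) v := by
      intro v
      unfold qq pp
      rw [Finset.insert_comm]
      congr 1
      simp only [Finset.mem_insert, eq_iff_iff]
      tauto
    simp_rw [e]
    have hc : (insert u ρ).card = ρ.card + 1 := Finset.card_insert_of_notMem h
    rw [sum_pp _ _ _ (by omega), hc]
    simp [pp, h, Nat.sub_sub]

lemma eml (p : V → ℝ) (q : V → V → ℝ) (c lam M D : ℝ) (hD : 0 < D)
    (hrow : ∀ u, ∑ v, q u v = c * p u) (hsymm : ∀ u v, q u v = q v u)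
    (hM : ∑ u, p u = M) (hM0 : 0 < M) (hc : 0 < c)
    (hexp : IsSpectralExpanderW (fun u v => q u v / D) lam) (B : Finset V) :
    |∑ u ∈ B, ∑ v ∈ B, q u v - c * (∑ u ∈ B, p u) ^ 2 / M| ≤
      lam * c * (∑ u ∈ B, p u - (∑ u ∈ B, p u) ^ 2 / M) := by
  set P := ∑ u ∈ B, p u with hP
  set ind : V → ℝ := fun u => if u ∈ B then 1 else 0 with hind
  have hpi : ∑ u, p u * ind u = P := by
    simp [hind, hP]
  have hrow' : ∀ u, ∑ v, q u v / D = c * p u / D := by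
    intro u; rw [← Finset.sum_div, hrow]
  have h1 := hexp (fun u => ind u - P / M) ?_
  · have e1 : ∑ u, ∑ v, q u v / D * (ind u - P / M) * (ind v - P / M) =
        (∑ u ∈ B, ∑ v ∈ B, q u v - c * P ^ 2 / M) / D := by
      have a1 : ∑ u, ∑ v, q u v * ind u * ind v = ∑ u ∈ B, ∑ v ∈ B, q u v := by
        simp [hind, Finset.sum_ite_mem]
      have a2 : ∑ u, ∑ v, q u v * ind u = c * P := by
        simp_rw [← Finset.sum_mul, hrow]
        rw [← hpi, Finset.mul_sum]
        exact Finset.sum_congr rfl fun _ _ => by ring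
      have a3 : ∑ u, ∑ v, q u v * ind v = c * P := by
        rw [Finset.sum_comm, ← a2]
        exact Finset.sum_congr rfl fun _ _ => Finset.sum_congr rfl fun _ _ => by rw [hsymm]
      have a4 : ∑ u, ∑ v, q u v = c * M := by
        simp_rw [hrow]; rw [← Finset.mul_sum, hM]
      have : ∀ u v, q u v / D * (ind u - P / M) * (ind v - P / M) =
        (1 / D) * (q u v * ind u * ind v) - (P / M / D) * (q u v * ind u)
          - (P / M / D) * (q u v * ind v) + ((P / M) ^ 2 / D) * q u v := by
        intro u v; ring
      simp_rw [this, Finset.sum_add_distrib, Finset.sum_sub_distrib, ← Finset.mul_sum]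
      rw [a1, a2, a3, a4]
      field_simp
      ring
    have e2 : ∑ u, (∑ v, q u v / D) * (ind u - P / M) ^ 2 = c * (P - P ^ 2 / M) / D := by
      have hsq : ∀ u, ind u ^ 2 = ind u := by intro u; simp only [hind]; split_ifs <;> norm_num
      have : ∀ u, (∑ v, q u v / D) * (ind u - P / M) ^ 2 =
        (c / D) * (p u * ind u) - (2 * c / D * (P / M)) * (p u * ind u)
          + (c / D * (P / M) ^ 2) * p u := by
        intro u; rw [hrow', sub_sq, hsq]; ring
      simp_rw [this, Finset.sum_add_distrib, Finset.sum_sub_distrib, ← Finset.mul_sum]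
      rw [hpi, hM]
      field_simp
      ring
    simp only at h1
    rw [e1, e2, abs_div, abs_of_pos hD, div_le_iff₀ hD] at h1
    refine h1.trans (le_of_eq ?_)
    field_simp
  · simp_rw [hrow']
    have : ∀ u, c * p u / D * (ind u - P / M) =
       (c / D) * (p u * ind u) - (c / D * (P / M)) * p u := by intro u; ring
    simp_rw [this, Finset.sum_sub_distrib, ← Finset.mul_sum]
    rw [hpi, hM]
    field_simp
    ring

/-- the mixing lemma in the link -/
lemma eml_link (X : Finset (Finset V)) (d : ℕ) (lam : ℝ)
    (hXd : IsPureDim X d) (hlse : IsLocalSpectralExpander X d lam)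
    (ρ : Finset V) (hρ : ρ ∈ X) (hc : ρ.card + 2 ≤ d + 1) (B : Finset V) :
    |∑ u ∈ B, ∑ v ∈ B, qq X (d + 1) ρ u v - ((d + 1 - ρ.card - 1 : ℕ) : ℝ) *
        (∑ u ∈ B, pp X (d + 1) ρ u) ^ 2 / (((d + 1 - ρ.card : ℕ) : ℝ) * nn X (d + 1) ρ)| ≤
      lam * ((d + 1 - ρ.card - 1 : ℕ) : ℝ) * (∑ u ∈ B, pp X (d + 1) ρ u -
        (∑ u ∈ B, pp X (d + 1) ρ u) ^ 2 / (((d + 1 - ρ.card : ℕ) : ℝ) * nn X (d + 1) ρ)) := by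
  have hn : 0 < nn X (d + 1) ρ := by
    unfold nn
    obtain ⟨T, h1, h2, h3⟩ := hXd.2.2 ρ hρ
    have : T ∈ (facesCard X (d + 1)).filter fun T => ρ ⊆ T := by
      simp [facesCard, h1, h2, h3]
    exact_mod_cast Finset.card_pos.2 ⟨T, this⟩
  have h0 : 0 < d + 1 - ρ.card := by omega
  have h1 : 0 < d + 1 - ρ.card - 1 := by omega
  have h2 : 0 < (d + 1 - ρ.card).choose 2 := Nat.choose_pos (by omega)
  refine eml (pp X (d + 1) ρ) (qq X (d + 1) ρ) _ lam _
    (nn X (d + 1) ρ * ((d + 1 - ρ.card).choose 2 : ℝ)) (by positivity)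
    (sum_qq X _ ρ (by omega)) (qq_symm X _ ρ) (sum_pp X _ ρ (by omega)) (by positivity)
    (by exact_mod_cast h1) ?_ B
  have := hlse ρ hρ hc
  have e : edgeWt (link X ρ) (d + 1 - ρ.card) = fun u v =>
      qq X (d + 1) ρ u v / (nn X (d + 1) ρ * ((d + 1 - ρ.card).choose 2 : ℝ)) := by
    funext u v; exact edgeWt_eq X (d + 1) ρ (by omega) u v
  rwa [e] at this

lemma nn_pos (X : Finset (Finset V)) (d : ℕ) (hXd : IsPureDim X d) (ρ : Finset V)
    (hρ : ρ ∈ X) : 0 < nn X (d + 1) ρ := by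
  unfold nn
  obtain ⟨T, h1, h2, h3⟩ := hXd.2.2 ρ hρ
  have : T ∈ (facesCard X (d + 1)).filter fun T => ρ ⊆ T := by
    simp [facesCard, h1, h2, h3]
  exact_mod_cast Finset.card_pos.2 ⟨T, this⟩

lemma lam_nonneg (X : Finset (Finset V)) (d : ℕ) (lam : ℝ) (hX : IsComplex X)
    (hXd : IsPureDim X d) (hlse : IsLocalSpectralExpander X d lam) (hd : 1 ≤ d) :
    0 ≤ lam := by
  obtain ⟨σ, hσ⟩ := hXd.1
  obtain ⟨T, hT, _, hc⟩ := hXd.2.2 σ hσ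
  have he : (∅ : Finset V) ∈ X := hX T hT _ (Finset.empty_subset _)
  obtain ⟨u, hu⟩ := Finset.card_pos.1 (by omega : 0 < T.card)
  have hu' : ({u} : Finset V) ∈ X := hX T hT _ (by simpa using hu)
  have h := eml_link X d lam hXd hlse ∅ he (by simp; omega) {u}
  have hp : 0 < pp X (d + 1) ∅ u := by simpa [pp] using nn_pos X d hXd _ hu'
  have hq : qq X (d + 1) ∅ u u = 0 := by simp [qq]
  have hle : pp X (d + 1) ∅ u ≤ ((d + 1 - (∅ : Finset V).card : ℕ) : ℝ) * nn X (d + 1) ∅ := by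
    rw [← sum_pp X (d + 1) ∅ (by simp)]
    exact Finset.single_le_sum (fun i _ => pp_nonneg X (d + 1) ∅ i) (Finset.mem_univ u)
  have hn := nn_pos X d hXd _ he
  simp only [Finset.sum_singleton, hq] at h
  set p := pp X (d + 1) ∅ u
  set M := ((d + 1 - (∅ : Finset V).card : ℕ) : ℝ) * nn X (d + 1) ∅ with hM
  set c := ((d + 1 - (∅ : Finset V).card - 1 : ℕ) : ℝ) with hcd
  have hc0 : 0 < c := by
    rw [hcd]; simp; omega
  have hM0 : 0 < M := lt_of_lt_of_le hp hle
  by_contra hl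
  push Not at hl
  have h1 : 0 ≤ p - p ^ 2 / M := by
    rw [sub_nonneg, div_le_iff₀ hM0]; nlinarith
  have h2 : 0 < c * p ^ 2 / M := by positivity
  have h3 : |0 - c * p ^ 2 / M| = c * p ^ 2 / M := by rw [zero_sub, abs_neg, abs_of_pos h2]
  rw [h3] at h
  have : lam * c * (p - p ^ 2 / M) ≤ 0 :=
    mul_nonpos_of_nonpos_of_nonneg (mul_nonpos_of_nonpos_of_nonneg hl.le hc0.le) h1
  linarith

lemma sum_aa_insert (X : Finset (Finset V)) (t m : ℕ) (A : Finset (Finset V)) (ρ : Finset V)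
    (hA : ∀ s ∈ A, s.card = m) :
    ∑ u, (if u ∉ ρ then aa X t A (insert u ρ) else 0) =
      ((m - ρ.card : ℕ) : ℝ) * aa X t A ρ := by
  unfold aa
  have : ∀ u, (if u ∉ ρ then ∑ σ ∈ A.filter (fun σ => insert u ρ ⊆ σ), nn X t σ else 0) =
      ∑ σ ∈ A, if u ∈ σ \ ρ ∧ ρ ⊆ σ then nn X t σ else 0 := by
    intro u
    by_cases h : u ∉ ρ
    · rw [if_pos h, Finset.sum_filter]
      refine Finset.sum_congr rfl fun T _ => ?_
      congr 1
      simp [Finset.insert_subset_iff, h]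
    · rw [if_neg h]; symm; apply Finset.sum_eq_zero; intro T _
      rw [if_neg]; simp at h; simp [h]
  simp_rw [this]
  rw [Finset.sum_comm, Finset.sum_filter, Finset.mul_sum]
  refine Finset.sum_congr rfl fun σ hσ => ?_
  by_cases h : ρ ⊆ σ
  · simp only [h, and_true, if_true]
    rw [← Finset.sum_filter, Finset.filter_mem_eq_inter, Finset.univ_inter]
    simp [Finset.card_sdiff_of_subset h, hA σ hσ]
  · simp [h]

lemma sum_aa (X : Finset (Finset V)) (t m l : ℕ) (A : Finset (Finset V))
    (hA : ∀ s ∈ A, s.card = m) :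
    ∑ ρ ∈ (Finset.univ : Finset V).powersetCard l, aa X t A ρ =
      (m.choose l : ℝ) * ∑ σ ∈ A, nn X t σ := by
  unfold aa
  simp_rw [Finset.sum_filter]
  rw [Finset.sum_comm, Finset.mul_sum]
  refine Finset.sum_congr rfl fun σ hσ => ?_
  rw [← Finset.sum_filter]
  have : ((Finset.univ : Finset V).powersetCard l).filter (fun ρ => ρ ⊆ σ) =
      σ.powersetCard l := by
    ext ρ; simp [Finset.mem_powersetCard]; tauto
  rw [this]
  simp [hA σ hσ]

lemma aa_nonneg (X : Finset (Finset V)) (t : ℕ) (A : Finset (Finset V)) (ρ : Finset V) :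
    0 ≤ aa X t A ρ := Finset.sum_nonneg fun _ _ => nn_nonneg _ _ _

noncomputable def BB (X : Finset (Finset V)) (d k : ℕ) (A : Finset (Finset V)) (x : ℝ)
    (ρ : Finset V) : Finset V :=
  Finset.univ.filter fun u => u ∉ ρ ∧ insert u ρ ∈ facesCard X k \ nonlocalS X (d + 1) k A x

lemma per_rho (X : Finset (Finset V)) (d : ℕ) (lam x : ℝ)
    (hX : IsComplex X) (hXd : IsPureDim X d) (hlse : IsLocalSpectralExpander X d lam)
    (hx : 0 < x) (k : ℕ) (hk1 : 1 ≤ k) (hk : k + 1 ≤ d)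
    (A : Finset (Finset V)) (hA : ∀ s ∈ A, s.card = k + 1) (ρ : Finset V)
    (hρ : ρ ∈ weakS X (d + 1) k A (x ^ 3)) :
    ∑ u ∈ BB X d k A x ρ, ∑ v ∈ BB X d k A x ρ, qq X (d + 1) ρ u v ≤
      2 * aa X (d + 1) A ρ * (x + lam * x⁻¹) := by
  simp only [weakS, facesCard, Finset.mem_filter] at hρ
  obtain ⟨⟨hρX, hρc⟩, hw⟩ := hρ
  have hlam := lam_nonneg X d lam hX hXd hlse (by omega)
  have hn := nn_pos X d hXd ρ hρX
  have he := eml_link X d lam hXd hlse ρ hρX (by omega) (BB X d k A x ρ)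
  rw [locWt_eq X (d + 1) (k + 1) A ρ hA (by omega)] at hw
  set B := BB X d k A x ρ with hB
  set P := ∑ u ∈ B, pp X (d + 1) ρ u with hP
  set Q := ∑ u ∈ B, ∑ v ∈ B, qq X (d + 1) ρ u v with hQ
  obtain ⟨c, hc⟩ : ∃ c : ℕ, d + 1 - ρ.card = c + 1 := ⟨d - ρ.card, by omega⟩
  have hc0 : 0 < (c : ℝ) := by
    have : 0 < c := by omega
    exact_mod_cast this
  have hm : k + 1 - ρ.card = 2 := by omega
  rw [hc, hm, Nat.cast_choose_two, div_le_iff₀ (by push_cast; rw [add_sub_cancel_right]; positivity)] at hw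
  rw [hc] at he
  simp only [Nat.add_sub_cancel] at he
  have hP0 : 0 ≤ P := Finset.sum_nonneg fun u _ => pp_nonneg X (d + 1) ρ u
  have hmark : x * c * P ≤ 2 * aa X (d + 1) A ρ := by
    have h2 := sum_aa_insert X (d + 1) (k + 1) A ρ hA
    rw [hm] at h2
    push_cast at h2
    rw [← h2, hP, Finset.mul_sum]
    refine (Finset.sum_le_sum (g := fun u =>
      if u ∉ ρ then aa X (d + 1) A (insert u ρ) else 0) fun u hu => ?_).trans
      (Finset.sum_le_sum_of_subset_of_nonneg (Finset.subset_univ B) fun u _ _ => ?_)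
    · simp only [hB, BB, Finset.mem_filter, Finset.mem_univ, true_and, Finset.mem_sdiff,
        nonlocalS, not_and, not_le] at hu
      obtain ⟨hu1, hu2, hu3⟩ := hu
      have hu3 := hu3 hu2
      simp only [facesCard, Finset.mem_filter] at hu2
      rw [locWt_eq X (d + 1) (k + 1) A _ hA (by omega)] at hu3
      have e1 : d + 1 - (insert u ρ).card = c := by omega
      have e2 : k + 1 - (insert u ρ).card = 1 := by omega
      have hn2 := nn_pos X d hXd _ hu2.1
      rw [e1, e2, Nat.choose_one_right, lt_div_iff₀ (by positivity)] at hu3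
      simp only [pp, if_pos hu1]
      linarith
    · split_ifs
      · exact le_refl _
      · exact aa_nonneg _ _ _ _
  set a := aa X (d + 1) A ρ with ha
  set M := ((c + 1 : ℕ) : ℝ) * nn X (d + 1) ρ with hM
  have hM0 : 0 < M := by positivity
  have hw' : 2 * a ≤ x ^ 3 * (M * c) := by
    rw [hM]; push_cast at hw ⊢; linarith
  have hPM : P ≤ x ^ 2 * M := by
    have : (x * c) * P ≤ (x * c) * (x ^ 2 * M) := by nlinarith
    exact le_of_mul_le_mul_left this (by positivity)
  have h1 := (abs_le.1 he).2
  have hPM2 : P ^ 2 / M ≤ P * x ^ 2 := by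
    rw [div_le_iff₀ hM0]; nlinarith
  have h3 : Q ≤ c * P * (x ^ 2 + lam) := by
    have a1 : c * P ^ 2 / M ≤ c * (P * x ^ 2) := by
      rw [mul_div_assoc]; exact mul_le_mul_of_nonneg_left hPM2 hc0.le
    have a2 : lam * c * (P - P ^ 2 / M) ≤ lam * c * P := by
      apply mul_le_mul_of_nonneg_left _ (by positivity)
      have : 0 ≤ P ^ 2 / M := by positivity
      linarith
    nlinarith
  have h4 : c * P * (x ^ 2 + lam) = (x * c * P) * (x + lam * x⁻¹) := by
    field_simp
  rw [h4] at h3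
  exact h3.trans (mul_le_mul_of_nonneg_right hmark (by positivity))

noncomputable def UU (X : Finset (Finset V)) (d k : ℕ) (A : Finset (Finset V))
    (x y : ℝ) : Finset (Finset V) :=
  A.filter fun σ =>
          ∃ τ ∈ facesCard X k \ nonlocalS X (d + 1) k A x,
          ∃ τ' ∈ facesCard X k \ nonlocalS X (d + 1) k A x,
            τ ≠ τ' ∧ τ ⊆ σ ∧ τ' ⊆ σ ∧ τ ∩ τ' ∈ weakS X (d + 1) k A y

lemma two_le (X : Finset (Finset V)) (d k : ℕ) (A : Finset (Finset V)) (x y : ℝ)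
    (hk1 : 1 ≤ k) (hA : ∀ s ∈ A, s.card = k + 1) :
    2 * ∑ σ ∈ UU X d k A x y, nn X (d + 1) σ ≤
      ∑ ρ ∈ weakS X (d + 1) k A y,
        ∑ u ∈ BB X d k A x ρ, ∑ v ∈ BB X d k A x ρ, qq X (d + 1) ρ u v := by
  let J := (weakS X (d + 1) k A y).sigma fun ρ => BB X d k A x ρ ×ˢ BB X d k A x ρ
  have e : ∑ ρ ∈ weakS X (d + 1) k A y,
        ∑ u ∈ BB X d k A x ρ, ∑ v ∈ BB X d k A x ρ, qq X (d + 1) ρ u v =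
      ∑ j ∈ J, qq X (d + 1) j.1 j.2.1 j.2.2 := by
    rw [Finset.sum_sigma]
    refine Finset.sum_congr rfl fun ρ _ => ?_
    rw [Finset.sum_product]
  let I : (Σ _ : Finset V, V × V) → Finset V → Prop := fun j σ =>
    (j.2.1 ≠ j.2.2 ∧ j.2.1 ∉ j.1 ∧ j.2.2 ∉ j.1) ∧ insert j.2.1 (insert j.2.2 j.1) = σ
  have h1 : ∀ j ∈ J, ∑ σ ∈ UU X d k A x y, (if I j σ then nn X (d + 1) σ else 0) ≤
      qq X (d + 1) j.1 j.2.1 j.2.2 := by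
    intro j _
    by_cases hj : j.2.1 ≠ j.2.2 ∧ j.2.1 ∉ j.1 ∧ j.2.2 ∉ j.1
    · simp only [I, qq, if_pos hj, hj, true_and, not_false_eq_true, ne_eq, and_true]
      rw [Finset.sum_ite_eq]
      split_ifs
      · exact le_refl _
      · exact nn_nonneg _ _ _
    · simp only [I, qq, if_neg hj]
      apply le_of_eq
      apply Finset.sum_eq_zero
      intro σ _
      rw [if_neg]
      exact fun h => hj h.1
  rw [e]
  refine le_trans ?_ (Finset.sum_le_sum h1)
  rw [Finset.sum_comm, Finset.mul_sum]
  refine Finset.sum_le_sum fun σ hσ => ?_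
  simp only [UU, Finset.mem_filter] at hσ
  obtain ⟨hσA, τ, hτ, τ', hτ', hne, hs, hs', hw⟩ := hσ
  have hwc : (τ ∩ τ').card = k - 1 := by
    simp only [weakS, facesCard, Finset.mem_filter] at hw; exact hw.1.2
  have hτc : τ.card = k := by
    simp only [facesCard, Finset.mem_sdiff, Finset.mem_filter] at hτ; exact hτ.1.2
  have hτc' : τ'.card = k := by
    simp only [facesCard, Finset.mem_sdiff, Finset.mem_filter] at hτ'; exact hτ'.1.2
  set ρ := τ ∩ τ' with hρ
  obtain ⟨u, hu⟩ := Finset.card_eq_one.1 (by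
    rw [hρ, Finset.card_sdiff_of_subset Finset.inter_subset_left, ← hρ]; omega : (τ \ ρ).card = 1)
  obtain ⟨v, hv⟩ := Finset.card_eq_one.1 (by
    rw [hρ, Finset.card_sdiff_of_subset Finset.inter_subset_right, ← hρ]; omega : (τ' \ ρ).card = 1)
  have eu : insert u ρ = τ := by
    rw [← Finset.sdiff_union_of_subset (Finset.inter_subset_left : ρ ⊆ τ), hu]; rfl
  have ev : insert v ρ = τ' := by
    rw [← Finset.sdiff_union_of_subset (Finset.inter_subset_right : ρ ⊆ τ'), hv]; rfl
  have huρ : u ∉ ρ := by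
    have : u ∈ τ \ ρ := by rw [hu]; simp
    exact (Finset.mem_sdiff.1 this).2
  have hvρ : v ∉ ρ := by
    have : v ∈ τ' \ ρ := by rw [hv]; simp
    exact (Finset.mem_sdiff.1 this).2
  have huv : u ≠ v := by
    rintro rfl; exact hne (eu.symm.trans ev)
  have hin : insert u (insert v ρ) = σ := by
    apply Finset.eq_of_subset_of_card_le
    · rw [ev]
      apply Finset.insert_subset _ hs'
      apply hs; rw [← eu]; simp
    · rw [Finset.card_insert_of_notMem (by simp [huv, huρ]),
        Finset.card_insert_of_notMem hvρ, hA σ hσA]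
      omega
  have hin' : insert v (insert u ρ) = σ := by rw [Finset.insert_comm]; exact hin
  have huB : u ∈ BB X d k A x ρ := by
    simp only [BB, Finset.mem_filter, Finset.mem_univ, true_and]
    exact ⟨huρ, by rw [eu]; exact hτ⟩
  have hvB : v ∈ BB X d k A x ρ := by
    simp only [BB, Finset.mem_filter, Finset.mem_univ, true_and]
    exact ⟨hvρ, by rw [ev]; exact hτ'⟩
  let j1 : (Σ _ : Finset V, V × V) := ⟨ρ, (u, v)⟩
  let j2 : (Σ _ : Finset V, V × V) := ⟨ρ, (v, u)⟩
  have hj : j1 ≠ j2 := by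
    intro h
    simp only [j1, j2, Sigma.mk.injEq, heq_eq_eq, Prod.mk.injEq, true_and] at h
    exact huv h.1
  have hsub : ({j1, j2} : Finset (Σ _ : Finset V, V × V)) ⊆ J := by
    intro j hj
    simp only [Finset.mem_insert, Finset.mem_singleton] at hj
    rcases hj with rfl | rfl
    · simp [J, j1, hw, huB, hvB]
    · simp [J, j2, hw, huB, hvB]
  refine le_trans (le_of_eq ?_) (Finset.sum_le_sum_of_subset_of_nonneg hsub fun j _ _ => ?_)
  · rw [Finset.sum_pair hj, if_pos, if_pos]
    · ring
    · exact ⟨⟨huv.symm, hvρ, huρ⟩, hin'⟩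
    · exact ⟨⟨huv, huρ, hvρ⟩, hin⟩
  · split_ifs
    · exact nn_nonneg _ _ _
    · exact le_refl _

lemma main (X : Finset (Finset V)) (d : ℕ) (lam x : ℝ)
    (hX : IsComplex X) (hXd : IsPureDim X d) (hlse : IsLocalSpectralExpander X d lam)
    (hx : 0 < x) (k : ℕ) (hk1 : 1 ≤ k) (hk : k + 1 ≤ d)
    (A : Finset (Finset V)) (hA : A ⊆ facesCard X (k + 1)) :
    wt X (d + 1) (k + 1) (UU X d k A x (x ^ 3)) ≤
      ((k + 1).choose 2 : ℝ) * (x + lam * x⁻¹) * wt X (d + 1) (k + 1) A := by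
  have hA' : ∀ s ∈ A, s.card = k + 1 := by
    intro s hs
    have := hA hs
    simp only [facesCard, Finset.mem_filter] at this
    exact this.2
  have hlam := lam_nonneg X d lam hX hXd hlse (by omega)
  have hU : ∀ s ∈ UU X d k A x (x ^ 3), s.card = k + 1 :=
    fun s hs => hA' s (Finset.filter_subset _ _ hs)
  rw [wt_eq _ _ _ _ hA', wt_eq _ _ _ _ hU,
    ← mul_div_assoc]
  apply div_le_div_of_nonneg_right _ (mul_nonneg (nn_nonneg _ _ _) (Nat.cast_nonneg _))
  have h1 := two_le X d k A x (x ^ 3) hk1 hA'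
  have h2 := Finset.sum_le_sum (per_rho X d lam x hX hXd hlse hx k hk1 hk A hA')
  rw [← Finset.sum_mul, ← Finset.mul_sum] at h2
  have h3 : ∑ ρ ∈ weakS X (d + 1) k A (x ^ 3), aa X (d + 1) A ρ ≤
      ∑ ρ ∈ (Finset.univ : Finset V).powersetCard (k - 1), aa X (d + 1) A ρ := by
    apply Finset.sum_le_sum_of_subset_of_nonneg
    · intro ρ hρ
      simp only [weakS, facesCard, Finset.mem_filter] at hρ
      simp [Finset.mem_powersetCard, hρ.1.2]
    · intro _ _ _; exact aa_nonneg _ _ _ _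
  rw [sum_aa X (d + 1) (k + 1) (k - 1) A hA'] at h3
  have h4 : (k + 1).choose (k - 1) = (k + 1).choose 2 := by
    rw [← Nat.choose_symm (by omega : k - 1 ≤ k + 1)]
    congr 1; omega
  rw [h4] at h3
  have hK : 0 ≤ x + lam * x⁻¹ := by positivity
  have h5 := mul_le_mul_of_nonneg_right h3 hK
  nlinarith

end HDXP

/-- in a `d`-dimensional `λ`-local spectral expander, for `A ⊆ X(k)`
(`1 ≤ k ≤ d-1`), with `S_{k-1} = {σ ∈ X(k-1) : ‖A_σ‖ ≤ η^(1/3)}` and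
`S_{k-2} = {σ ∈ X(k-2) : ‖A_σ‖ ≤ η}`, the set `Υ` of `k`-faces `σ ∈ A` containing two
`(k-1)`-faces `τ, τ' ∉ S_{k-1}` with `τ ∩ τ' ∈ S_{k-2}` satisfies
`‖Υ‖ ≤ C(k+1,2)·(η^(1/3) + λ·η^(-1/3))·‖A‖`. -/
theorem stmt12 {V : Type*} [Fintype V] [DecidableEq V]
    (X : Finset (Finset V)) (d : ℕ) (lam η : ℝ)
    (hX : HDX.IsComplex X) (hXd : HDX.IsPureDim X d)
    (hlse : HDX.IsLocalSpectralExpander X d lam)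
    (hη0 : 0 < η) (hη1 : η < 1)
    (k : ℕ) (hk1 : 1 ≤ k) (hk : k + 1 ≤ d)
    (A : Finset (Finset V)) (hA : A ⊆ HDX.facesCard X (k + 1)) :
    HDX.wt X (d + 1) (k + 1)
        (A.filter fun σ =>
          ∃ τ ∈ HDX.facesCard X k \ HDX.nonlocalS X (d + 1) k A (η ^ ((1 : ℝ) / 3)),
          ∃ τ' ∈ HDX.facesCard X k \ HDX.nonlocalS X (d + 1) k A (η ^ ((1 : ℝ) / 3)),
            τ ≠ τ' ∧ τ ⊆ σ ∧ τ' ⊆ σ ∧ τ ∩ τ' ∈ HDX.weakS X (d + 1) k A η) ≤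
      ((k + 1).choose 2 : ℝ) * (η ^ ((1 : ℝ) / 3) + lam * η ^ (-(1 : ℝ) / 3)) *
        HDX.wt X (d + 1) (k + 1) A := by
  have hx : 0 < η ^ ((1 : ℝ) / 3) := Real.rpow_pos_of_pos hη0 _
  have h3 : (η ^ ((1 : ℝ) / 3)) ^ 3 = η := by
    rw [← Real.rpow_natCast, ← Real.rpow_mul hη0.le]; norm_num
  have hinv : η ^ (-(1 : ℝ) / 3) = (η ^ ((1 : ℝ) / 3))⁻¹ := by
    rw [← Real.rpow_neg hη0.le]; congr 1; ring
  have h := HDXP.main X d lam (η ^ ((1 : ℝ) / 3)) hX hXd hlse hx k hk1 hk A hA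
  rw [h3] at h
  rw [hinv]
  exact h
end

section
/- Fix d ∈ ℕ and 0 < λ, η, ε, α < 1 with ε ≤ α/(3d³), λ ≤ ε² and η ≤ ε³. Let X be a d-dimensional λ-local spectral expander. For any A ⊆ X(k) with 1 ≤ k ≤ d−1, if A is (η,ε,α)-weakly-non-local and ‖δ₁(A)‖ = 0, then A = ∅. -/
/- Common framework: weighted simplicial complexes, links, localizations,
   local spectral expansion, cochains, coboundaries, minimality, etc. -/

open Finset

open scoped Classical

namespace HDX
variable {V : Type*} [Fintype V] [DecidableEq V]

noncomputable def Usum (m : ℕ) (s : Finset V) (f : Finset V → ℝ) : ℝ :=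
  ∑ σ ∈ (powersetCard m univ).filter (fun σ => s ⊆ σ), f σ

noncomputable def NN (Y : Finset (Finset V)) (t : ℕ) (s : Finset V) : ℝ :=
  (((facesCard Y t).filter (fun T => s ⊆ T)).card : ℝ)

theorem Usum_step (m : ℕ) (s : Finset V) (f : Finset V → ℝ) :
    ∑ u ∈ sᶜ, Usum m (insert u s) f = ((m : ℝ) - s.card) * Usum m s f := by
  unfold Usum
  have h : ∀ u ∈ sᶜ, (∑ σ ∈ (powersetCard m univ).filter (fun σ => insert u s ⊆ σ), f σ)
      = ∑ σ ∈ (powersetCard m univ).filter (fun σ => s ⊆ σ), if u ∈ σ then f σ else 0 := by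
    intro u _
    rw [← Finset.sum_filter, Finset.filter_filter]
    apply Finset.sum_congr _ (fun _ _ => rfl)
    ext σ
    simp only [mem_filter, insert_subset_iff]
    tauto
  rw [Finset.sum_congr rfl h, Finset.sum_comm, Finset.mul_sum]
  apply Finset.sum_congr rfl
  intro σ hσ
  simp only [mem_filter, mem_powersetCard, subset_univ, true_and] at hσ
  rw [← Finset.sum_filter, Finset.sum_const, nsmul_eq_mul]
  congr 1
  have : (sᶜ.filter (fun u => u ∈ σ)) = σ \ s := by
    ext; simp; tauto
  rw [this, Finset.card_sdiff_of_subset hσ.2, Nat.cast_sub (card_le_card hσ.2), hσ.1]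

theorem Usum_self (s : Finset V) (f : Finset V → ℝ) : Usum s.card s f = f s := by
  unfold Usum
  have : (powersetCard s.card univ).filter (fun σ => s ⊆ σ) = {s} := by
    ext σ
    simp only [mem_filter, mem_powersetCard, subset_univ, true_and, mem_singleton]
    constructor
    · rintro ⟨h1, h2⟩
      exact (Finset.eq_of_subset_of_card_le h2 h1.le).symm
    · rintro rfl; simp
  rw [this, sum_singleton]

theorem NN_eq (Y : Finset (Finset V)) (t : ℕ) (s : Finset V) :
    NN Y t s = Usum t s (fun T => if T ∈ Y then 1 else 0) := by
  unfold NN Usum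
  rw [← Finset.sum_filter, Finset.sum_const, nsmul_eq_mul, mul_one]
  congr 2
  ext T
  simp [facesCard]; tauto

theorem NN_bal (Y : Finset (Finset V)) (t : ℕ) (s : Finset V) :
    ∑ u ∈ sᶜ, NN Y t (insert u s) = ((t : ℝ) - s.card) * NN Y t s := by
  simp only [NN_eq]; exact Usum_step _ _ _

theorem NN_nonneg (Y : Finset (Finset V)) (t : ℕ) (s : Finset V) : 0 ≤ NN Y t s := by
  unfold NN; positivity

theorem NN_pos {Y : Finset (Finset V)} {d : ℕ} (h : IsPureDim Y d) {s : Finset V} (hs : s ∈ Y) :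
    0 < NN Y (d+1) s := by
  unfold NN
  obtain ⟨T, hT, hsT, hc⟩ := h.2.2 s hs
  have : 0 < ((facesCard Y (d+1)).filter (fun T => s ⊆ T)).card := by
    apply card_pos.mpr ⟨T, by simp [facesCard, hT, hsT, hc]⟩
  exact_mod_cast this

theorem NN_zero {Y : Finset (Finset V)} {t : ℕ} (h : IsComplex Y) {s : Finset V} (hs : s ∉ Y) :
    NN Y t s = 0 := by
  unfold NN
  rw [Nat.cast_eq_zero, card_eq_zero, filter_eq_empty_iff]
  intro T hT hsT
  exact hs (h T (mem_filter.1 hT).1 s hsT)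

theorem NN_empty (Y : Finset (Finset V)) (t : ℕ) : NN Y t ∅ = ((facesCard Y t).card : ℝ) := by
  simp [NN]

theorem wt_eq (Y : Finset (Finset V)) (t m : ℕ) (A : Finset (Finset V)) :
    wt Y t m A = (∑ s ∈ A.filter (fun s => s.card = m), NN Y t s) /
      (NN Y t ∅ * (t.choose m : ℝ)) := by
  rw [NN_empty]
  unfold wt
  congr 1
  unfold NN
  have h1 : ∀ s : Finset V, (((facesCard Y t).filter (fun T => s ⊆ T)).card : ℝ)
    = ∑ T ∈ facesCard Y t, if s ⊆ T then 1 else 0 := by intro s; simp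
  simp only [h1]
  rw [Finset.sum_comm]
  apply sum_congr rfl
  intro T _
  rw [← Finset.sum_filter, Finset.sum_const, nsmul_eq_mul, mul_one]
  congr 2
  ext s
  simp [mem_powersetCard]; tauto

theorem link_faces (X : Finset (Finset V)) (t : ℕ) (σ : Finset V) (h : σ.card ≤ t) :
    facesCard (link X σ) (t - σ.card) =
      ((facesCard X t).filter (fun T => σ ⊆ T)).image (fun T => T \ σ) := by
  ext s
  simp only [facesCard, link, localize, mem_filter, mem_image]
  constructor
  · rintro ⟨⟨T, ⟨hT, hs⟩, rfl⟩, hc⟩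
    refine ⟨T, ⟨⟨hT, ?_⟩, hs⟩, rfl⟩
    rw [card_sdiff_of_subset hs] at hc
    have := card_le_card hs
    omega
  · rintro ⟨T, ⟨⟨hT, hc⟩, hs⟩, rfl⟩
    refine ⟨⟨T, ⟨hT, hs⟩, rfl⟩, ?_⟩
    rw [card_sdiff_of_subset hs, hc]

theorem sdiff_injOn (F : Finset (Finset V)) (σ : Finset V) :
    Set.InjOn (fun T : Finset V => T \ σ) ((F.filter (fun T => σ ⊆ T) : Finset (Finset V)) : Set (Finset V)) := by
  intro T hT T' hT' h
  simp only [coe_filter, Set.mem_ofPred_eq] at hT hT'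
  have h' : T \ σ = T' \ σ := h
  rw [← sdiff_union_of_subset hT.2, h', sdiff_union_of_subset hT'.2]

theorem NN_link (X : Finset (Finset V)) (t : ℕ) (σ s : Finset V) (h : σ.card ≤ t) :
    NN (link X σ) (t - σ.card) s = if Disjoint s σ then NN X t (σ ∪ s) else 0 := by
  have key : NN (link X σ) (t - σ.card) s =
      ((((facesCard X t).filter (fun T => σ ⊆ T)).filter (fun T => s ⊆ T \ σ)).card : ℝ) := by
    unfold NN
    rw [link_faces X t σ h, filter_image, card_image_of_injOn]
    intro T hT T' hT' hh
    apply sdiff_injOn (facesCard X t) σ _ _ hh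
    · exact (filter_subset _ _) hT
    · exact (filter_subset _ _) hT'
  rw [key]
  split_ifs with hd
  · unfold NN
    congr 2
    ext T
    simp only [mem_filter, subset_sdiff, union_subset_iff]
    tauto
  · rw [Nat.cast_eq_zero, card_eq_zero, filter_eq_empty_iff]
    intro T _ hT
    exact hd (subset_sdiff.1 hT).2

theorem locWt_eq (X : Finset (Finset V)) (t m : ℕ) (A : Finset (Finset V)) (σ : Finset V)
    (h : σ.card ≤ t) (hm : σ.card ≤ m) (hA : ∀ τ ∈ A, τ.card = m) :
    locWt X t A m σ = Usum m σ (fun τ => if τ ∈ A then NN X t τ else 0) /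
      (NN X t σ * ((t - σ.card).choose (m - σ.card) : ℝ)) := by
  unfold locWt
  rw [wt_eq, NN_link _ _ _ _ h]
  simp only [disjoint_empty_left, if_true, union_empty]
  congr 1
  have h1 : (localize A σ).filter (fun s => s.card = m - σ.card) = localize A σ := by
    apply filter_true_of_mem
    intro s hs
    simp only [localize, mem_image, mem_filter] at hs
    obtain ⟨τ, ⟨h1, h2⟩, rfl⟩ := hs
    rw [card_sdiff_of_subset h2, hA τ h1]
  rw [h1]
  unfold localize
  rw [sum_image (sdiff_injOn A σ)]
  unfold Usum
  rw [← sum_filter]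
  apply sum_congr
  · ext τ
    simp only [mem_filter, mem_powersetCard, subset_univ, true_and]
    constructor
    · rintro ⟨a, b⟩; exact ⟨⟨hA τ a, b⟩, a⟩
    · rintro ⟨⟨a, b⟩, c⟩; exact ⟨c, b⟩
  · intro τ hτ
    simp only [mem_filter, mem_powersetCard, subset_univ, true_and] at hτ
    rw [NN_link _ _ _ _ h, if_pos sdiff_disjoint, union_sdiff_of_subset hτ.1.2]

/-- conversion -/
theorem sum_conv (m : ℕ) (F : Finset V → V → ℝ) :
    ∑ σ ∈ powersetCard (m+1) (univ : Finset V), ∑ j ∈ σ, F (σ.erase j) j =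
      ∑ τ ∈ powersetCard m (univ : Finset V), ∑ j ∈ τᶜ, F τ j := by
  rw [Finset.sum_sigma', Finset.sum_sigma']
  refine Finset.sum_bij' (fun x _ => ⟨x.1.erase x.2, x.2⟩) (fun x _ => ⟨insert x.2 x.1, x.2⟩) ?_ ?_ ?_ ?_ ?_
  · rintro ⟨σ, j⟩ h
    simp only [mem_sigma, mem_powersetCard, subset_univ, true_and] at h ⊢
    rw [card_erase_of_mem h.2, h.1]; simp
  · rintro ⟨σ, j⟩ h
    simp only [mem_sigma, mem_powersetCard, subset_univ, true_and, mem_compl] at h ⊢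
    rw [card_insert_of_notMem h.2, h.1]; simp
  · rintro ⟨σ, j⟩ h
    simp only [mem_sigma, mem_powersetCard, subset_univ, true_and] at h ⊢
    rw [insert_erase h.2]
  · rintro ⟨σ, j⟩ h
    simp only [mem_sigma, mem_powersetCard, subset_univ, true_and, mem_compl] at h ⊢
    rw [erase_insert h.2]
  · rintro ⟨σ, j⟩ h
    rfl

theorem mix_abs (w : V → V → ℝ) (lam : ℝ) (h : IsSpectralExpanderW w lam)
    (hs : ∀ u v, w u v = w v u) (g : V → ℝ) (hg : ∀ u, g u ^ 2 = g u)
    (P s E : ℝ) (hP : P = ∑ u, ∑ v, w u v) (hP0 : 0 < P)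
    (hs' : s = ∑ u, (∑ v, w u v) * g u) (hE : E = ∑ u, ∑ v, w u v * g u * g v) :
    E * P ≤ s ^ 2 + lam * s * (P - s) := by
  have h0 := h (fun u => g u - s / P) (by
    simp only [mul_sub, sum_sub_distrib, ← sum_mul]
    rw [← hs', ← hP]; field_simp; ring)
  have e1 : ∑ u, ∑ v, w u v * (g u - s / P) * (g v - s / P) = E - s ^ 2 / P := by
    have : ∀ u v, w u v * (g u - s / P) * (g v - s / P) =
      w u v * g u * g v - (s / P) * (w u v * g u) - (s/P) * (w u v * g v) + (s/P)^2 * w u v := by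
      intros; ring
    simp only [this, sum_add_distrib, sum_sub_distrib, ← mul_sum]
    have e2 : ∑ u, ∑ v, w u v * g v = s := by
      rw [sum_comm, hs']
      apply sum_congr rfl; intro u _
      rw [sum_mul]
      apply sum_congr rfl; intro v _
      rw [hs]
    have e3 : ∑ u, ∑ v, w u v * g u = s := by
      rw [hs']; simp only [sum_mul]
    rw [e2, e3, ← hE, ← hP]; field_simp; ring
  have e4 : ∑ u, (∑ v, w u v) * (g u - s / P) ^ 2 = s - s ^ 2 / P := by
    have : ∀ u, (∑ v, w u v) * (g u - s / P) ^ 2 = (∑ v, w u v) * g u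
      - (2 * s / P) * ((∑ v, w u v) * g u) + (s/P)^2 * (∑ v, w u v) := by
      intro u
      have := hg u
      linear_combination (∑ v, w u v) * this
    simp only [this, sum_add_distrib, sum_sub_distrib, ← mul_sum]
    rw [← hs', ← hP]; field_simp; ring
  simp only [e1, e4] at h0
  have h1 := (abs_le.1 h0).2
  have h2 := mul_le_mul_of_nonneg_right h1 hP0.le
  have e5 : (E - s ^ 2 / P) * P = E * P - s ^ 2 := by field_simp
  have e6 : lam * (s - s ^ 2 / P) * P = lam * s * (P - s) := by field_simp
  rw [e5, e6] at h2
  linarith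

theorem mixF (X : Finset (Finset V)) (d : ℕ) (lam : ℝ) (hXd : IsPureDim X d)
    (hlse : IsLocalSpectralExpander X d lam) (σ : Finset V) (hσ : σ ∈ X) (hc : σ.card + 2 ≤ d + 1)
    (g : V → ℝ) (hg : ∀ u, g u ^ 2 = g u) (M s E D : ℝ)
    (hD : D = ((d + 1 : ℕ) : ℝ) - σ.card)
    (hM : M = D * NN X (d+1) σ)
    (hs : s = ∑ u ∈ σᶜ, NN X (d+1) (insert u σ) * g u)
    (hE : E = ∑ u ∈ σᶜ, ∑ v ∈ (insert u σ)ᶜ, NN X (d+1) (insert v (insert u σ)) * g u * g v) :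
    E * M ≤ (D - 1) * (s ^ 2 + lam * s * (M - s)) := by
  have hN := NN_pos hXd hσ
  have hD2 : 2 ≤ D := by
    rw [hD]; have : ((σ.card + 2 : ℕ) : ℝ) ≤ ((d+1 : ℕ) : ℝ) := by exact_mod_cast hc
    push_cast at this ⊢; linarith
  set c : ℝ := NN X (d+1) σ * ((d + 1 - σ.card).choose 2 : ℝ) with hcdef
  have hc0 : 0 < c := by
    apply mul_pos hN
    have : 0 < (d + 1 - σ.card).choose 2 := Nat.choose_pos (by omega)
    exact_mod_cast this
  have hw : ∀ u v, edgeWt (link X σ) (d + 1 - σ.card) u v =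
      (if u ∈ σᶜ then (if v ∈ (insert u σ)ᶜ then NN X (d+1) (insert v (insert u σ)) else 0) else 0) / c := by
    intro u v
    unfold edgeWt
    by_cases huv : u = v
    · subst huv; simp
    · rw [if_pos huv, wt_eq]
      have hcard : ({u, v} : Finset V).card = 2 := card_pair huv
      rw [filter_true_of_mem (by simp [hcard]), sum_singleton, NN_link _ _ _ _ (by omega),
        NN_link _ _ _ _ (by omega)]
      simp only [disjoint_empty_left, if_true, union_empty]
      rw [← hcdef]
      congr 1
      have e : σ ∪ {u, v} = insert v (insert u σ) := by ext; simp; tauto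
      rw [e]
      by_cases hu : u ∈ σ <;> by_cases hv : v ∈ σ <;> simp [hu, hv, Ne.symm huv, huv]
  set w : V → V → ℝ := edgeWt (link X σ) (d + 1 - σ.card) with hwdef
  have hsymm : ∀ u v, w u v = w v u := by
    intro u v
    rw [hwdef]; unfold edgeWt
    rw [pair_comm u v]; simp only [ne_comm]
  have hrow : ∀ u, ∑ v, w u v = if u ∈ σᶜ then (D - 1) * NN X (d+1) (insert u σ) / c else 0 := by
    intro u
    simp only [hw, ← sum_div]
    split_ifs with hu
    · rw [Finset.sum_ite_mem, univ_inter, NN_bal, card_insert_of_notMem (by simpa using hu), hD]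
      push_cast; ring_nf
    · simp
  have hP : ∑ u, ∑ v, w u v = (D - 1) * M / c := by
    simp only [hrow]
    rw [Finset.sum_ite_mem, univ_inter, ← sum_div, ← mul_sum, NN_bal, ← hD, hM]
  have hS : ∑ u, (∑ v, w u v) * g u = (D - 1) * s / c := by
    simp only [hrow, ite_mul, zero_mul]
    rw [Finset.sum_ite_mem, univ_inter, hs, mul_sum, sum_div]
    apply sum_congr rfl; intros; ring
  have hEE : ∑ u, ∑ v, w u v * g u * g v = E / c := by
    have : ∀ u, ∑ v, w u v * g u * g v = if u ∈ σᶜ then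
        (∑ v ∈ (insert u σ)ᶜ, NN X (d+1) (insert v (insert u σ)) * g u * g v) / c else 0 := by
      intro u
      simp only [hw]
      split_ifs with hu
      · rw [sum_div]
        rw [← univ_inter (insert u σ)ᶜ, ← Finset.sum_ite_mem, univ_inter]
        apply sum_congr rfl; intro v _
        split_ifs <;> ring
      · simp
    simp only [this]
    rw [Finset.sum_ite_mem, univ_inter, hE, sum_div]
  have hM0 : 0 < M := by rw [hM]; apply mul_pos _ hN; linarith
  have := mix_abs w lam (hlse σ hσ hc) hsymm g hg ((D-1) * M / c) ((D-1)*s/c) (E/c) hP.symm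
    (by apply div_pos (mul_pos _ hM0) hc0; linarith) hS.symm hEE.symm
  have e1 : E / c * ((D-1) * M / c) = (D-1) * (E * M) / c^2 := by field_simp
  have e2 : ((D - 1) * s / c) ^ 2 + lam * ((D - 1) * s / c) * ((D - 1) * M / c - (D - 1) * s / c)
    = (D-1) * ((D - 1) * (s ^ 2 + lam * s * (M - s))) / c^2 := by field_simp
  rw [e1, e2, div_le_div_iff_of_pos_right (by positivity)] at this
  exact le_of_mul_le_mul_left this (by linarith)
end HDX
namespace HDX
variable {V : Type*} [Fintype V] [DecidableEq V]

theorem L_s (k : ℕ) (W a φ : Finset V → ℝ) :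
    ∑ τ ∈ powersetCard k (univ : Finset V), φ τ * ∑ u ∈ τᶜ, W (insert u τ) * a (insert u τ) =
    ∑ σ ∈ powersetCard (k+1) (univ : Finset V), a σ * W σ * ∑ j ∈ σ, φ (σ.erase j) := by
  have := sum_conv k (fun (τ : Finset V) j => φ τ * (W (insert j τ) * a (insert j τ)))
  simp only [mul_sum]
  rw [← this]
  apply sum_congr rfl; intro σ _
  apply sum_congr rfl; intro j hj
  rw [insert_erase hj]; ring

theorem L_E (k : ℕ) (W a φ ψ : Finset V → ℝ) :
    ∑ τ ∈ powersetCard k (univ : Finset V), φ τ * ∑ u ∈ τᶜ, ∑ v ∈ (insert u τ)ᶜ,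
      W (insert v (insert u τ)) * a (insert u τ) * ψ (insert v τ) =
    ∑ σ ∈ powersetCard (k+1) (univ : Finset V), a σ * ∑ i ∈ σᶜ, W (insert i σ) *
      ∑ j ∈ σ, φ (σ.erase j) * ψ (insert i (σ.erase j)) := by
  have := sum_conv k (fun (τ : Finset V) u => φ τ * ∑ v ∈ (insert u τ)ᶜ,
      W (insert v (insert u τ)) * a (insert u τ) * ψ (insert v τ))
  simp only [mul_sum] at this ⊢
  rw [← this]
  apply sum_congr rfl; intro σ _
  rw [sum_comm]
  apply sum_congr rfl; intro j hj
  rw [insert_erase hj]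
  apply sum_congr rfl; intro i hi
  ring

theorem L_F (m : ℕ) (W a ψ : Finset V → ℝ) :
    ∑ ω ∈ powersetCard m (univ : Finset V), ∑ u ∈ ωᶜ, ∑ v ∈ (insert u ω)ᶜ,
      W (insert v (insert u ω)) * a (insert v (insert u ω)) * (ψ (insert u ω) * ψ (insert v ω)) =
    ∑ σ ∈ powersetCard (m+2) (univ : Finset V), a σ * W σ *
      ∑ j ∈ σ, ∑ l ∈ σ.erase j, ψ (σ.erase j) * ψ (σ.erase l) := by
  have h1 := sum_conv (m+1) (fun (τ : Finset V) j => a (insert j τ) * W (insert j τ) *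
    ∑ l ∈ τ, ψ τ * ψ ((insert j τ).erase l))
  have h2 := sum_conv m (fun (ω : Finset V) l => ∑ v ∈ (insert l ω)ᶜ, 
     W (insert v (insert l ω)) * a (insert v (insert l ω)) * (ψ (insert l ω) * ψ ((insert v (insert l ω)).erase l)))
  have e1 : ∑ ω ∈ powersetCard m (univ : Finset V), ∑ u ∈ ωᶜ, ∑ v ∈ (insert u ω)ᶜ,
      W (insert v (insert u ω)) * a (insert v (insert u ω)) * (ψ (insert u ω) * ψ (insert v ω)) =
      ∑ τ ∈ powersetCard m (univ : Finset V), ∑ l ∈ τᶜ, ∑ v ∈ (insert l τ)ᶜ, 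
     W (insert v (insert l τ)) * a (insert v (insert l τ)) * (ψ (insert l τ) * ψ ((insert v (insert l τ)).erase l)) := by
    apply sum_congr rfl; intro ω _
    apply sum_congr rfl; intro u hu
    apply sum_congr rfl; intro v hv
    have : (insert v (insert u ω)).erase u = insert v ω := by
      simp only [mem_compl, mem_insert, not_or] at hu hv
      rw [erase_insert_of_ne (by tauto), erase_insert hu]
    rw [this]
  rw [e1, ← h2]
  have e2 : ∑ σ ∈ powersetCard (m+2) (univ : Finset V), a σ * W σ *
      ∑ j ∈ σ, ∑ l ∈ σ.erase j, ψ (σ.erase j) * ψ (σ.erase l) = 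
      ∑ σ ∈ powersetCard (m+1+1) (univ : Finset V), ∑ j ∈ σ, a (insert j (σ.erase j)) * W (insert j (σ.erase j)) *
    ∑ l ∈ σ.erase j, ψ (σ.erase j) * ψ ((insert j (σ.erase j)).erase l) := by
    apply sum_congr rfl; intro σ _
    rw [mul_sum]
    apply sum_congr rfl; intro j hj
    rw [insert_erase hj]
  rw [e2, h1]
  apply sum_congr rfl; intro τ _
  simp only [mul_sum]
  rw [sum_comm]
  apply sum_congr rfl; intro l hl
  rw [insert_erase hl]
  apply sum_congr rfl; intro v _
  ring

theorem pt1 (σ : Finset V) (h b : V → ℝ) (hh : ∀ j, h j = 0 ∨ h j = 1) (hb : ∀ j, b j = 0 ∨ b j = 1)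
    (he : ∃ j ∈ σ, b j = 1) :
    ∑ j ∈ σ, h j * (1 - b j) ≤ ∑ j ∈ σ, (1 - h j) * b j + ∑ j ∈ σ, ∑ l ∈ σ.erase j, h j * h l := by
  have hB : 1 ≤ ∑ j ∈ σ, b j := by
    obtain ⟨j, hj, hj1⟩ := he
    rw [← hj1]
    apply single_le_sum (f := b) _ hj
    intro i _; rcases hb i with h | h <;> rw [h] <;> norm_num
  have e1 : ∑ j ∈ σ, ∑ l ∈ σ.erase j, h j * h l = (∑ j ∈ σ, h j) ^ 2 - ∑ j ∈ σ, h j := by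
    rw [sq, sum_mul_sum, ← sum_sub_distrib]
    apply sum_congr rfl; intro j hj
    rw [← add_sum_erase _ _ hj]
    rcases hh j with h | h <;> rw [h] <;> ring
  have e2 : ∑ j ∈ σ, h j * (1 - b j) - ∑ j ∈ σ, (1 - h j) * b j = ∑ j ∈ σ, h j - ∑ j ∈ σ, b j := by
    rw [← sum_sub_distrib, ← sum_sub_distrib]
    apply sum_congr rfl; intros; ring
  nlinarith [sq_nonneg (∑ j ∈ σ, h j - 1)]

theorem pt2 (σ : Finset V) (h b : V → ℝ) (hh : ∀ j, h j = 0 ∨ h j = 1) (hb : ∀ j, b j = 0 ∨ b j = 1)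
    (he : ∃ j ∈ σ, b j = 1) :
    1 ≤ ∑ j ∈ σ, (1 - h j) * b j + ∑ j ∈ σ, h j := by
  have hB : 1 ≤ ∑ j ∈ σ, b j := by
    obtain ⟨j, hj, hj1⟩ := he
    rw [← hj1]
    apply single_le_sum (f := b) _ hj
    intro i _; rcases hb i with h | h <;> rw [h] <;> norm_num
  refine hB.trans ?_
  rw [← sum_add_distrib]
  apply sum_le_sum
  intro j _
  rcases hb j with h1 | h1 <;> rcases hh j with h2 | h2 <;> rw [h1, h2] <;> norm_num

theorem exists_other {X : Finset (Finset V)} {d k : ℕ} (hX : IsComplex X) (hXd : IsPureDim X d)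
    (hk : k + 1 ≤ d)
    (A : Finset (Finset V)) (hA : A ⊆ facesCard X (k + 1))
    (hδ1 : wt X (d + 1) (k + 2) (delta1 X (k + 1) A) = 0) (σ : Finset V) (hσ : σ ∈ A) (i : V)
    (hi : i ∉ σ) (hW : NN X (d+1) (insert i σ) ≠ 0) : ∃ j ∈ σ, insert i (σ.erase j) ∈ A := by
  have hρ : insert i σ ∈ X := by
    by_contra h; exact hW (NN_zero hX h)
  have hσc : σ.card = k + 1 := (mem_filter.1 (hA hσ)).2
  have hρc : (insert i σ).card = k + 2 := by rw [card_insert_of_notMem hi, hσc]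
  have hempty : (∅ : Finset V) ∈ X := hX _ hρ _ (empty_subset _)
  rw [wt_eq, div_eq_zero_iff] at hδ1
  have hne : ¬ (NN X (d+1) ∅ * ((d+1).choose (k+2) : ℝ) = 0) := by
    apply ne_of_gt
    apply mul_pos (NN_pos hXd hempty)
    exact_mod_cast Nat.choose_pos (by omega)
  have h0 := hδ1.resolve_right hne
  rw [sum_eq_zero_iff_of_nonneg (fun s _ => NN_nonneg _ _ _)] at h0
  have hnot : insert i σ ∉ delta1 X (k+1) A := fun h =>
    hW (h0 _ (mem_filter.2 ⟨h, hρc⟩))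
  have hcard : ((powersetCard (k+1) (insert i σ)).filter (· ∈ A)).card ≠ 1 := by
    intro h
    exact hnot (mem_filter.2 ⟨mem_filter.2 ⟨hρ, hρc⟩, h⟩)
  have hmem : σ ∈ (powersetCard (k+1) (insert i σ)).filter (· ∈ A) := by
    simp [mem_powersetCard, hσ, hσc, subset_insert]
  have hlt : 1 < ((powersetCard (k+1) (insert i σ)).filter (· ∈ A)).card := by
    have := card_pos.2 ⟨σ, hmem⟩
    omega
  obtain ⟨σ', h1, h2⟩ := exists_mem_ne hlt σ
  simp only [mem_filter, mem_powersetCard] at h1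
  obtain ⟨⟨hsub, hc⟩, hA'⟩ := h1
  have hex : ∃ j ∈ σ, j ∉ σ' := by
    by_contra hcon
    push Not at hcon
    exact h2 (eq_of_subset_of_card_le hcon (by omega)).symm
  obtain ⟨j, hj, hj'⟩ := hex
  refine ⟨j, hj, ?_⟩
  have : σ' = insert i (σ.erase j) := by
    apply eq_of_subset_of_card_le
    · intro x hx
      have := hsub hx
      simp only [mem_insert, mem_erase] at this ⊢
      rcases this with h | h
      · exact Or.inl h
      · exact Or.inr ⟨fun e => hj' (e ▸ hx), h⟩
    · have := card_insert_le i (σ.erase j)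
      rw [card_erase_of_mem hj] at this
      omega
  rw [← this]; exact hA'

theorem final_arith (d k : ℕ) (lam ε α A Hh L C : ℝ) (hk1 : 1 ≤ k) (hk : k + 1 ≤ d)
    (hε0 : 0 < ε) (hα0 : 0 < α) (hα1 : α < 1) (hlam0 : 0 < lam)
    (hεα : ε ≤ α / (3 * (d : ℝ) ^ 3)) (hlamε : lam ≤ ε ^ 2)
    (hA : 0 < A) (hL : L ≤ (k + 1) * A)
    (h1 : α * (1 - lam) * Hh ≤ (ε + lam) * L + C)
    (h2 : A ≤ (ε + lam) * L + Hh) (hC : C ≤ 3 * ε * ((k + 1) * k) * A) : False := by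
  have hd : (2 : ℝ) ≤ d := by exact_mod_cast (by omega : 2 ≤ d)
  have hkd : (k : ℝ) + 1 ≤ d := by exact_mod_cast hk
  have hk0 : (1 : ℝ) ≤ k := by exact_mod_cast hk1
  rw [le_div_iff₀ (by positivity)] at hεα
  have hd3 : (2 : ℝ) * d ^ 2 ≤ d ^ 3 := by nlinarith [sq_nonneg (d : ℝ)]
  have hd2 : (2 : ℝ) * d ≤ d ^ 2 := by nlinarith
  have hed2 : ε * d ^ 2 ≤ α / 6 := by nlinarith
  have hed : ε * d ≤ α / 12 := by nlinarith
  have he : ε ≤ α / 24 := by nlinarith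
  have hlam : lam ≤ ε / 24 := by nlinarith
  have hL' : (ε + lam) * L ≤ α / 10 * A := by
    have : (ε + lam) * L ≤ (25/24 * ε) * (d * A) := by
      apply (mul_le_mul_of_nonneg_left hL (by positivity)).trans
      have : ((k:ℝ)+1) * A ≤ d * A := by nlinarith
      apply mul_le_mul (by linarith) this (by positivity) (by positivity)
    nlinarith
  have hC' : C ≤ α / 2 * A := by
    have : ((k:ℝ)+1) * k ≤ d ^ 2 := by nlinarith
    have : ε * (((k:ℝ)+1) * k) ≤ α / 6 := (mul_le_mul_of_nonneg_left this hε0.le).trans hed2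
    nlinarith
  have hH : 9/10 * A ≤ Hh := by nlinarith
  have hl : 9/10 ≤ 1 - lam := by nlinarith
  have h3 : α * (9/10) * (9/10 * A) ≤ α * (1 - lam) * Hh := by
    apply mul_le_mul (by nlinarith) hH (by positivity)
    apply mul_nonneg hα0.le; linarith
  nlinarith [mul_pos hα0 hA]
end HDX
namespace HDX
variable {V : Type*} [Fintype V] [DecidableEq V]

noncomputable def ind (A : Finset (Finset V)) (s : Finset V) : ℝ := if s ∈ A then 1 else 0

theorem ind_01 (A : Finset (Finset V)) (s : Finset V) : ind A s = 0 ∨ ind A s = 1 := by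
  unfold ind; split_ifs <;> simp

theorem ind_nonneg (A : Finset (Finset V)) (s : Finset V) : 0 ≤ ind A s := by
  unfold ind; split_ifs <;> simp

theorem ind_le (A : Finset (Finset V)) (s : Finset V) : ind A s ≤ 1 := by
  unfold ind; split_ifs <;> simp

theorem ind_sq (A : Finset (Finset V)) (s : Finset V) : ind A s ^ 2 = ind A s := by
  unfold ind; split_ifs <;> simp

noncomputable def SS (X A : Finset (Finset V)) (t : ℕ) (τ : Finset V) : ℝ :=
  ∑ u ∈ τᶜ, NN X t (insert u τ) * ind A (insert u τ)

noncomputable def EE (X A : Finset (Finset V)) (t : ℕ) (τ : Finset V) : ℝ :=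
  ∑ u ∈ τᶜ, ∑ v ∈ (insert u τ)ᶜ,
    NN X t (insert v (insert u τ)) * ind A (insert u τ) * ind A (insert v τ)

theorem SS_nonneg (X A : Finset (Finset V)) (t : ℕ) (τ : Finset V) : 0 ≤ SS X A t τ :=
  sum_nonneg fun _ _ => mul_nonneg (NN_nonneg _ _ _) (ind_nonneg _ _)

theorem SS_eq (X A : Finset (Finset V)) (t : ℕ) (τ : Finset V) :
    SS X A t τ = Usum (τ.card + 1) τ (fun τ => if τ ∈ A then NN X t τ else 0) := by
  have := Usum_step (τ.card + 1) τ (fun τ => if τ ∈ A then NN X t τ else 0)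
  push_cast at this
  rw [add_sub_cancel_left, one_mul] at this
  rw [← this]
  apply sum_congr rfl; intro u hu
  rw [mem_compl] at hu
  rw [← card_insert_of_notMem hu, Usum_self]
  unfold ind; split_ifs <;> simp

theorem SS_loc (X A : Finset (Finset V)) (d : ℕ) (hXd : IsPureDim X d) (τ : Finset V) (hτ : τ ∈ X)
    (k : ℕ) (hkd : k + 1 ≤ d) (hc : τ.card = k) (hA : A ⊆ facesCard X (k+1)) (c : ℝ)
    (h : locWt X (d+1) A (k+1) τ ≤ c) :
    SS X A (d+1) τ ≤ c * ((((d + 1 : ℕ) : ℝ) - τ.card) * NN X (d+1) τ) := by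
  rw [locWt_eq X (d+1) (k+1) A τ (by omega) (by omega) (fun τ hτ => (mem_filter.1 (hA hτ)).2),
    ← hc, ← SS_eq] at h
  have hN := NN_pos hXd hτ
  have e : (((d+1 - τ.card).choose (τ.card + 1 - τ.card) : ℕ) : ℝ) = ((d + 1 : ℕ) : ℝ) - τ.card := by
    rw [Nat.add_sub_cancel_left, Nat.choose_one_right, Nat.cast_sub (by omega)]
  have hp : 0 < ((d + 1 : ℕ) : ℝ) - τ.card := by
    rw [sub_pos]; exact_mod_cast (by omega)
  rw [e, div_le_iff₀ (by positivity)] at h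
  linarith

theorem QQ_loc (X A : Finset (Finset V)) (d : ℕ) (hXd : IsPureDim X d) (ω : Finset V) (hω : ω ∈ X)
    (m : ℕ) (hkd : m + 2 ≤ d) (hc : ω.card = m) (hA : A ⊆ facesCard X (m+2)) (c : ℝ)
    (h : locWt X (d+1) A (m+2) ω ≤ c) :
    ∑ u ∈ ωᶜ, SS X A (d+1) (insert u ω) ≤
      c * ((((d + 1 : ℕ) : ℝ) - m - 1) * ((((d + 1 : ℕ) : ℝ) - m) * NN X (d+1) ω)) := by
  rw [locWt_eq X (d+1) (m+2) A ω (by omega) (by omega) (fun τ hτ => (mem_filter.1 (hA hτ)).2)] at h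
  have hN := NN_pos hXd hω
  have e0 : ∑ u ∈ ωᶜ, SS X A (d+1) (insert u ω) =
      2 * Usum (m+2) ω (fun τ => if τ ∈ A then NN X (d+1) τ else 0) := by
    have := Usum_step (m+2) ω (fun τ => if τ ∈ A then NN X (d+1) τ else 0)
    rw [hc] at this
    push_cast at this
    rw [add_sub_cancel_left] at this
    rw [← this]
    apply sum_congr rfl; intro u hu
    rw [mem_compl] at hu
    rw [SS_eq, card_insert_of_notMem hu, hc]
  have e : (((d+1 - ω.card).choose (m + 2 - ω.card) : ℕ) : ℝ) =
      (((d + 1 : ℕ) : ℝ) - m) * (((d + 1 : ℕ) : ℝ) - m - 1) / 2 := by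
    rw [hc, Nat.add_sub_cancel_left, Nat.cast_choose_two, Nat.cast_sub (by omega)]
  have hp : (1:ℝ) < ((d + 1 : ℕ) : ℝ) - m := by
    rw [lt_sub_iff_add_lt]; exact_mod_cast (by omega)
  have hp' : 0 < ((d + 1 : ℕ) : ℝ) - m - 1 := by linarith
  have hp'' : 0 < ((d + 1 : ℕ) : ℝ) - m := by linarith
  rw [e, div_le_iff₀ (by positivity)] at h
  rw [e0]
  linarith

theorem EE_bound (X A : Finset (Finset V)) (d : ℕ) (lam : ℝ) (hXd : IsPureDim X d)
    (hlse : IsLocalSpectralExpander X d lam) (τ : Finset V) (hτ : τ ∈ X) (hc : τ.card + 2 ≤ d + 1)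
    (D : ℝ) (hD : D = ((d + 1 : ℕ) : ℝ) - τ.card) :
    EE X A (d+1) τ * (D * NN X (d+1) τ) ≤ (D - 1) * (SS X A (d+1) τ ^ 2 +
      lam * SS X A (d+1) τ * (D * NN X (d+1) τ - SS X A (d+1) τ)) :=
  mixF X d lam hXd hlse τ hτ hc (fun u => ind A (insert u τ)) (fun _ => ind_sq _ _) _ _ _ D hD rfl rfl rfl

theorem zero_off (X A : Finset (Finset V)) (t : ℕ) (hX : IsComplex X) (τ : Finset V) (hτ : τ ∉ X) :
    SS X A t τ = 0 ∧ EE X A t τ = 0 := by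
  have h : ∀ s, τ ⊆ s → NN X t s = 0 := fun s hs => NN_zero hX fun h => hτ (hX s h τ hs)
  constructor
  · apply sum_eq_zero; intro u _
    rw [h _ (subset_insert _ _), zero_mul]
  · apply sum_eq_zero; intro u _
    apply sum_eq_zero; intro v _
    rw [h _ ((subset_insert _ _).trans (subset_insert _ _)), zero_mul, zero_mul]

theorem NN_total (X : Finset (Finset V)) (t m : ℕ) :
    ∑ s ∈ powersetCard m (univ : Finset V), NN X t s = NN X t ∅ * (t.choose m : ℝ) := by
  rw [NN_empty]
  unfold NN
  have h1 : ∀ s : Finset V, (((facesCard X t).filter (fun T => s ⊆ T)).card : ℝ)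
    = ∑ T ∈ facesCard X t, if s ⊆ T then 1 else 0 := by intro s; simp
  simp only [h1]
  rw [sum_comm, ← nsmul_eq_mul, ← sum_const]
  apply sum_congr rfl
  intro T hT
  rw [← sum_filter, sum_const, nsmul_eq_mul, mul_one]
  congr 1
  rw [← (mem_filter.1 hT).2, ← card_powersetCard]
  congr 1
  ext s
  simp [mem_powersetCard]; tauto

theorem bad_bound (X A : Finset (Finset V)) (d m : ℕ) (hX : IsComplex X) (hXd : IsPureDim X d)
    (hkd : m + 2 ≤ d) (hA : A ⊆ facesCard X (m+2)) (G : Finset (Finset V)) (hG : G ⊆ facesCard X m)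
    (ε : ℝ) (h : wt X (d+1) m G ≥ 1 - ε * wt X (d+1) (m+2) A) :
    ∑ ω ∈ powersetCard m (univ : Finset V), (1 - ind G ω) *
      ((((d + 1 : ℕ) : ℝ) - m - 1) * ((((d + 1 : ℕ) : ℝ) - m) * NN X (d+1) ω)) ≤
    ε * ((m + 2) * (m + 1)) * ∑ σ ∈ powersetCard (m+2) (univ : Finset V), ind A σ * NN X (d+1) σ := by
  have hsum : ∀ (B : Finset (Finset V)) (n : ℕ), ∑ s ∈ B.filter (fun s => s.card = n), NN X (d+1) s
      = ∑ σ ∈ powersetCard n (univ : Finset V), ind B σ * NN X (d+1) σ := by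
    intro B n
    unfold ind
    simp only [ite_mul, one_mul, zero_mul]
    rw [← sum_filter]
    apply sum_congr _ (fun _ _ => rfl)
    ext s
    simp [mem_powersetCard]; tauto
  rw [wt_eq, wt_eq, hsum, hsum] at h
  set 𝒜 := ∑ σ ∈ powersetCard (m+2) (univ : Finset V), ind A σ * NN X (d+1) σ
  set 𝒢 := ∑ σ ∈ powersetCard m (univ : Finset V), ind G σ * NN X (d+1) σ with hGdef
  have hemp : (∅ : Finset V) ∈ X := by
    obtain ⟨s, hs⟩ := hXd.1
    exact hX s hs _ (empty_subset _)
  have hN := NN_pos hXd hemp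
  have hc1 : (0:ℝ) < ((d+1).choose m : ℕ) := by exact_mod_cast Nat.choose_pos (by omega)
  have hc2 : (0:ℝ) < ((d+1).choose (m+2) : ℕ) := by exact_mod_cast Nat.choose_pos (by omega)
  have hch : ((d+1).choose (m+2) : ℝ) * ((m+2) * (m+1)) =
      ((d+1).choose m : ℝ) * ((((d+1 : ℕ) : ℝ) - m) * (((d+1 : ℕ) : ℝ) - m - 1)) := by
    have h1 := Nat.choose_succ_right_eq (d+1) m
    have h2 := Nat.choose_succ_right_eq (d+1) (m+1)
    have h1' : ((d+1).choose (m+1) : ℝ) * (m+1) = ((d+1).choose m : ℝ) * (((d+1 : ℕ) : ℝ) - m) := by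
      rw [← Nat.cast_sub (by omega)]; exact_mod_cast h1
    have h2' : ((d+1).choose (m+2) : ℝ) * (m+2) = ((d+1).choose (m+1) : ℝ) * (((d+1 : ℕ) : ℝ) - m - 1) := by
      have : (((d+1 : ℕ) : ℝ) - m - 1) = ((d + 1 - (m+1) : ℕ) : ℝ) := by
        rw [Nat.cast_sub (by omega)]; push_cast; ring
      rw [this]; exact_mod_cast h2
    linear_combination (m+1 : ℝ) * h2' + (((d+1 : ℕ) : ℝ) - m - 1) * h1'
  have e : ∑ ω ∈ powersetCard m (univ : Finset V), (1 - ind G ω) *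
      ((((d + 1 : ℕ) : ℝ) - m - 1) * ((((d + 1 : ℕ) : ℝ) - m) * NN X (d+1) ω)) =
      ((((d + 1 : ℕ) : ℝ) - m - 1) * (((d + 1 : ℕ) : ℝ) - m)) *
        (NN X (d+1) ∅ * ((d+1).choose m : ℝ) - 𝒢) := by
    rw [← NN_total, hGdef, ← sum_sub_distrib, mul_sum]
    apply sum_congr rfl; intros; ring
  rw [e]
  set N := NN X (d+1) ∅
  set c1 : ℝ := (((d+1).choose m : ℕ) : ℝ)
  set c2 : ℝ := (((d+1).choose (m+2) : ℕ) : ℝ)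
  set q := ((((d + 1 : ℕ) : ℝ) - m - 1) * (((d + 1 : ℕ) : ℝ) - m)) with hq
  have hq0 : 0 ≤ q := by
    have : ((m:ℝ) + 1) ≤ ((d + 1 : ℕ) : ℝ) := by exact_mod_cast (by omega)
    apply mul_nonneg <;> linarith
  have h3 : N * c1 - 𝒢 ≤ ε * 𝒜 * c1 / c2 := by
    have := mul_le_mul_of_nonneg_right h (mul_pos hN hc1).le
    rw [div_mul_cancel₀ _ (mul_pos hN hc1).ne'] at this
    have e2 : (1 - ε * (𝒜 / (N * c2))) * (N * c1) = N * c1 - ε * 𝒜 * c1 / c2 := by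
      field_simp
    linarith
  have h4 := mul_le_mul_of_nonneg_left h3 hq0
  refine h4.trans (le_of_eq ?_)
  rw [mul_div_assoc', div_eq_iff hc2.ne']
  linear_combination (- ε * 𝒜) * hch

theorem good_arith (D h E M Q ε η lam : ℝ) (hD1 : 1 < D) (hh0 : 0 ≤ h) (hM0 : 0 < M) (hε0 : 0 < ε)
    (hlam0 : 0 < lam) (hlamε : lam ≤ ε ^ 2) (hηε : η ≤ ε ^ 3) (hhQ : ε * ((D - 1) * h) ≤ Q)
    (hQ : Q ≤ η * ((D - 1) * M)) (hmix : E * M ≤ (D - 1) * (h ^ 2 + lam * h * (M - h))) :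
    E ≤ 2 * ε * Q := by
  have hhM : h ≤ ε ^ 2 * M := by
    have h1 : (ε * (D-1)) * h ≤ (ε * (D-1)) * (ε^2 * M) := by
      have : η * ((D-1) * M) ≤ ε^3 * ((D-1) * M) :=
        mul_le_mul_of_nonneg_right hηε (mul_nonneg (by linarith) hM0.le)
      calc (ε * (D-1)) * h = ε * ((D - 1) * h) := by ring
        _ ≤ ε^3 * ((D-1) * M) := by linarith
        _ = _ := by ring
    exact le_of_mul_le_mul_left h1 (mul_pos hε0 (by linarith))
  have hE1 : E ≤ (D-1) * h * (2 * ε^2) := by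
    have : E * M ≤ ((D-1) * h * (2 * ε^2)) * M := by
      refine hmix.trans ?_
      have h1 : h ^ 2 + lam * h * (M - h) ≤ h * (2 * ε^2) * M := by
        have a1 : h * h ≤ h * (ε^2 * M) := mul_le_mul_of_nonneg_left hhM hh0
        have a2 : lam * (h * M) ≤ ε^2 * (h * M) := mul_le_mul_of_nonneg_right hlamε (by positivity)
        have a3 : 0 ≤ lam * h * h := by positivity
        linarith
      have := mul_le_mul_of_nonneg_left h1 (by linarith : 0 ≤ D - 1)
      linarith
    exact le_of_mul_le_mul_right this hM0
  have := mul_le_mul_of_nonneg_left hhQ (by positivity : 0 ≤ 2 * ε)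
  linarith

theorem F_bound (X A H G : Finset (Finset V)) (d m : ℕ) (hX : IsComplex X) (hXd : IsPureDim X d)
    (lam η ε : ℝ) (hlse : IsLocalSpectralExpander X d lam) (hlam0 : 0 < lam) (hε0 : 0 < ε)
    (hlamε : lam ≤ ε ^ 2) (hηε : η ≤ ε ^ 3)
    (hkd : m + 2 ≤ d) (hA : A ⊆ facesCard X (m+2)) 
    (hH : ∀ τ ∈ H, ε * ((((d + 1 : ℕ) : ℝ) - m - 1) * NN X (d+1) τ) ≤ SS X A (d+1) τ)
    (hG : ∀ ω ∈ G, ω ∈ X ∧ locWt X (d+1) A (m+2) ω ≤ η)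
    (ω : Finset V) (hω : ω.card = m) :
    ∑ u ∈ ωᶜ, ∑ v ∈ (insert u ω)ᶜ, NN X (d+1) (insert v (insert u ω)) *
      ind A (insert v (insert u ω)) * (ind H (insert u ω) * ind H (insert v ω)) ≤
    2 * ε * (∑ u ∈ ωᶜ, SS X A (d+1) (insert u ω)) + (1 - ind G ω) *
      ((((d + 1 : ℕ) : ℝ) - m - 1) * ((((d + 1 : ℕ) : ℝ) - m) * NN X (d+1) ω)) := by
  have hSS0 : 0 ≤ ∑ u ∈ ωᶜ, SS X A (d+1) (insert u ω) := sum_nonneg fun _ _ => SS_nonneg _ _ _ _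
  set D : ℝ := ((d + 1 : ℕ) : ℝ) - m with hD
  have hD1 : 1 < D := by
    rw [hD, lt_sub_iff_add_lt]; exact_mod_cast (by omega)
  by_cases hg : ω ∈ G
  · obtain ⟨hωX, hloc⟩ := hG ω hg
    have hQ := QQ_loc X A d hXd ω hωX m hkd hω hA η hloc
    rw [← hD] at hQ
    have hN := NN_pos hXd hωX
    have hone : ind G ω = 1 := by simp [ind, hg]
    rw [hone, sub_self, zero_mul, add_zero]
    set h : ℝ := ∑ u ∈ ωᶜ, NN X (d+1) (insert u ω) * ind H (insert u ω) with hh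
    have hh0 : 0 ≤ h := sum_nonneg fun _ _ => mul_nonneg (NN_nonneg _ _ _) (ind_nonneg _ _)
    set E : ℝ := ∑ u ∈ ωᶜ, ∑ v ∈ (insert u ω)ᶜ, NN X (d+1) (insert v (insert u ω)) *
      ind H (insert u ω) * ind H (insert v ω) with hE
    have hmix := mixF X d lam hXd hlse ω hωX (by omega) (fun u => ind H (insert u ω))
      (fun _ => ind_sq _ _) _ h E D (by rw [hω]) rfl hh hE
    set M := D * NN X (d+1) ω with hM
    have hM0 : 0 < M := mul_pos (by linarith) hN
    have hhQ : ε * ((D - 1) * h) ≤ ∑ u ∈ ωᶜ, SS X A (d+1) (insert u ω) := by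
      rw [hh, mul_sum, mul_sum]
      apply sum_le_sum; intro u _
      by_cases hu : insert u ω ∈ H
      · have := hH _ hu
        simp only [ind, hu, if_true, mul_one]; exact this
      · simp only [ind, hu, if_false, mul_zero]; exact SS_nonneg _ _ _ _
    set Q := ∑ u ∈ ωᶜ, SS X A (d+1) (insert u ω)
    have hEQ := good_arith D h E M Q ε η lam hD1 hh0 hM0 hε0 hlam0 hlamε hηε hhQ hQ hmix
    have hFE : ∑ u ∈ ωᶜ, ∑ v ∈ (insert u ω)ᶜ, NN X (d+1) (insert v (insert u ω)) *
      ind A (insert v (insert u ω)) * (ind H (insert u ω) * ind H (insert v ω)) ≤ E := by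
      apply sum_le_sum; intro u _
      apply sum_le_sum; intro v _
      have h1 := NN_nonneg X (d+1) (insert v (insert u ω))
      have h2 := ind_le A (insert v (insert u ω))
      have h3 := mul_nonneg (ind_nonneg H (insert u ω)) (ind_nonneg H (insert v ω))
      rw [mul_assoc _ (ind H _) (ind H _)]
      apply mul_le_mul_of_nonneg_right _ h3
      exact mul_le_of_le_one_right h1 h2
    exact hFE.trans hEQ
  · have hzero : ind G ω = 0 := by simp [ind, hg]
    rw [hzero, sub_zero, one_mul]
    have e : ∑ u ∈ ωᶜ, ∑ v ∈ (insert u ω)ᶜ, NN X (d+1) (insert v (insert u ω)) =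
        (D - 1) * (D * NN X (d+1) ω) := by
      have : ∀ u ∈ ωᶜ, ∑ v ∈ (insert u ω)ᶜ, NN X (d+1) (insert v (insert u ω)) =
          (D - 1) * NN X (d+1) (insert u ω) := by
        intro u hu
        rw [mem_compl] at hu
        rw [NN_bal, card_insert_of_notMem hu, hω, hD]; push_cast; ring
      rw [sum_congr rfl this, ← mul_sum, NN_bal, hω]
    rw [← e]
    have : 0 ≤ 2 * ε * (∑ u ∈ ωᶜ, SS X A (d+1) (insert u ω)) := by positivity
    refine le_trans ?_ (le_add_of_nonneg_left this)
    apply sum_le_sum; intro u _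
    apply sum_le_sum; intro v _
    have h1 := NN_nonneg X (d+1) (insert v (insert u ω))
    have h2 := ind_le A (insert v (insert u ω))
    have h2' := ind_nonneg A (insert v (insert u ω))
    have h3 : ind H (insert u ω) * ind H (insert v ω) ≤ 1 :=
      mul_le_one₀ (ind_le _ _) (ind_nonneg _ _) (ind_le _ _)
    have h4 := mul_nonneg (ind_nonneg H (insert u ω)) (ind_nonneg H (insert v ω))
    rw [mul_assoc]
    apply mul_le_of_le_one_right h1
    exact mul_le_one₀ h2 h4 h3
end HDX
namespace HDX
variable {V : Type*} [Fintype V] [DecidableEq V]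

theorem light_arith (D S M E ε lam : ℝ) (hD : 1 ≤ D) (hM : 0 < M) (hS : 0 ≤ S) (hl : 0 < lam)
    (hSM : S ≤ ε * M) (h : E * M ≤ (D - 1) * (S ^ 2 + lam * S * (M - S))) :
    E ≤ (D - 1) * ((ε + lam) * S) := by
  have h1 : S ^ 2 + lam * S * (M - S) ≤ ((ε + lam) * S) * M := by
    have a1 : S * S ≤ S * (ε * M) := mul_le_mul_of_nonneg_left hSM hS
    have a3 : 0 ≤ lam * S * S := by positivity
    linarith
  have := mul_le_mul_of_nonneg_left h1 (by linarith : 0 ≤ D - 1)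
  have h2 : E * M ≤ ((D - 1) * ((ε + lam) * S)) * M := by linarith
  exact le_of_mul_le_mul_right h2 hM

theorem heavy_arith (D S M E α lam : ℝ) (hD : 1 ≤ D) (hM : 0 < M) (hS : 0 ≤ S) (hl : lam < 1)
    (hSM : S ≤ (1 - α) * M) (h : E * M ≤ (D - 1) * (S ^ 2 + lam * S * (M - S))) :
    (D - 1) * (α * (1 - lam) * S) ≤ (D - 1) * S - E := by
  have h1 : α * (1 - lam) * S * M ≤ S * M - (S ^ 2 + lam * S * (M - S)) := by
    have a1 : (S * (1 - lam)) * (α * M) ≤ (S * (1 - lam)) * (M - S) :=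
      mul_le_mul_of_nonneg_left (by linarith) (mul_nonneg hS (by linarith))
    linarith
  have := mul_le_mul_of_nonneg_left h1 (by linarith : 0 ≤ D - 1)
  have h2 : ((D - 1) * (α * (1 - lam) * S)) * M ≤ ((D - 1) * S - E) * M := by linarith
  exact le_of_mul_le_mul_right h2 hM

theorem core (X : Finset (Finset V)) (d : ℕ) (lam η ε α : ℝ)
    (hX : IsComplex X) (hXd : IsPureDim X d)
    (hlse : IsLocalSpectralExpander X d lam)
    (hlam0 : 0 < lam) (hlam1 : lam < 1)
    (hε0 : 0 < ε) (hα0 : 0 < α) (hα1 : α < 1)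
    (hεα : ε ≤ α / (3 * (d : ℝ) ^ 3)) (hlamε : lam ≤ ε ^ 2) (hηε : η ≤ ε ^ 3)
    (m : ℕ) (hk : m + 2 ≤ d)
    (A : Finset (Finset V)) (hA : A ⊆ facesCard X (m + 2))
    (hwnl : IsWeaklyNonlocal X (d + 1) (m + 1) A η ε α)
    (hδ1 : wt X (d + 1) (m + 3) (delta1 X (m + 2) A) = 0) :
    A = ∅ := by
  by_contra hne
  obtain ⟨σ0, hσ0⟩ := nonempty_iff_ne_empty.2 hne
  set W := NN X (d+1) with hW
  have hW0 : ∀ s, 0 ≤ W s := NN_nonneg X (d+1)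
  set D : ℝ := ((d + 1 : ℕ) : ℝ) - m - 1 with hD
  have hD1 : 1 < D := by
    rw [hD, lt_sub_iff_add_lt, lt_sub_iff_add_lt]; exact_mod_cast (by omega)
  set G := weakS X (d+1) (m+1) A η with hG
  set H := (facesCard X (m+1)).filter (fun τ => ε * (D * W τ) ≤ SS X A (d+1) τ) with hH
  set 𝒜 : ℝ := ∑ σ ∈ powersetCard (m+2) (univ : Finset V), ind A σ * W σ with h𝒜
  set S := SS X A (d+1) with hS
  set E := EE X A (d+1) with hE
  have hS0 : ∀ τ, 0 ≤ S τ := SS_nonneg X A (d+1)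
  have h𝒜0 : 0 < 𝒜 := by
    have hm := hA hσ0
    have hp : 0 < ind A σ0 * W σ0 := by
      have : ind A σ0 = 1 := by simp [ind, hσ0]
      rw [this, one_mul]; exact NN_pos hXd (mem_filter.1 hm).1
    refine hp.trans_le (single_le_sum (f := fun σ => ind A σ * W σ)
      (fun σ _ => mul_nonneg (ind_nonneg _ _) (hW0 _)) ?_)
    simp [mem_powersetCard, (mem_filter.1 hm).2]
  have hcd : ∀ τ : Finset V, τ ∈ powersetCard (m+1) (univ : Finset V) → τ.card = m + 1 :=
    fun τ h => (mem_powersetCard.1 h).2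
  have hDτ : ∀ τ : Finset V, τ.card = m + 1 → D = ((d+1 : ℕ) : ℝ) - τ.card := by
    intro τ h; rw [h, hD]; push_cast; ring
  -- local estimates
  have hlight : ∀ τ ∈ powersetCard (m+1) (univ : Finset V),
      (1 - ind H τ) * E τ ≤ (D - 1) * ((ε + lam) * ((1 - ind H τ) * S τ)) := by
    intro τ hτ
    have hc := hcd τ hτ
    by_cases hτX : τ ∈ X
    · by_cases hτH : τ ∈ H
      · simp [ind, hτH]
      · have : ind H τ = 0 := by simp [ind, hτH]
        rw [this, sub_zero, one_mul, one_mul]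
        have hM : 0 < D * W τ := mul_pos (by linarith) (NN_pos hXd hτX)
        apply light_arith D (S τ) (D * W τ) (E τ) ε lam hD1.le hM (hS0 τ) hlam0
        · by_contra hcon
          exact hτH (mem_filter.2 ⟨mem_filter.2 ⟨hτX, hc⟩, (not_le.1 hcon).le⟩)
        · exact EE_bound X A d lam hXd hlse τ hτX (by omega) D (hDτ τ hc)
    · have := zero_off X A (d+1) hX τ hτX
      rw [hE, hS, this.1, this.2]; simp
  have hheavy : ∀ τ ∈ powersetCard (m+1) (univ : Finset V),
      (D - 1) * (α * (1 - lam) * S τ) ≤ (D - 1) * S τ - E τ := by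
    intro τ hτ
    have hc := hcd τ hτ
    by_cases hτX : τ ∈ X
    · have hM : 0 < D * W τ := mul_pos (by linarith) (NN_pos hXd hτX)
      apply heavy_arith D (S τ) (D * W τ) (E τ) α lam hD1.le hM (hS0 τ) hlam1
      · have := SS_loc X A d hXd τ hτX (m+1) hk hc hA (1 - α)
          (hwnl.2 τ (mem_filter.2 ⟨hτX, hc⟩))
        rw [← hDτ τ hc] at this; exact this
      · exact EE_bound X A d lam hXd hlse τ hτX (by omega) D (hDτ τ hc)
    · have := zero_off X A (d+1) hX τ hτX
      rw [hE, hS, this.1, this.2]; simp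
  -- global sums
  have hSsum : ∑ τ ∈ powersetCard (m+1) (univ : Finset V), S τ = (m + 2) * 𝒜 := by
    have := L_s (m+1) W (ind A) (fun _ => 1)
    simp only [one_mul] at this
    rw [hS]; unfold SS
    rw [this, h𝒜, mul_sum]
    apply sum_congr rfl; intro σ hσ
    rw [sum_const, (mem_powersetCard.1 hσ).2]; push_cast; simp; ring
  set HH := ∑ τ ∈ powersetCard (m+1) (univ : Finset V), ind H τ * S τ with hHH
  have hHH2 : HH = ∑ σ ∈ powersetCard (m+2) (univ : Finset V), ind A σ * W σ *
      ∑ j ∈ σ, ind H (σ.erase j) := L_s (m+1) W (ind A) (ind H)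
  have hHH0 : 0 ≤ HH := sum_nonneg fun τ _ => mul_nonneg (ind_nonneg _ _) (hS0 _)
  set L := ∑ τ ∈ powersetCard (m+1) (univ : Finset V), (1 - ind H τ) * S τ with hL
  have hLle : L ≤ (m + 2) * 𝒜 := by
    rw [← hSsum, hL]
    apply sum_le_sum; intro τ _
    have := mul_nonneg (ind_nonneg H τ) (hS0 τ)
    linarith
  set X1 := ∑ τ ∈ powersetCard (m+1) (univ : Finset V), (1 - ind H τ) * E τ with hX1
  have hX1le : X1 ≤ (D - 1) * ((ε + lam) * L) := by
    rw [hX1, hL, mul_sum, mul_sum]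
    exact sum_le_sum hlight
  have hX1eq : X1 = ∑ σ ∈ powersetCard (m+2) (univ : Finset V), ind A σ * ∑ i ∈ σᶜ, W (insert i σ) *
      ∑ j ∈ σ, (1 - ind H (σ.erase j)) * ind A (insert i (σ.erase j)) :=
    L_E (m+1) W (ind A) (fun τ => 1 - ind H τ) (ind A)
  set X2 := ∑ σ ∈ powersetCard (m+2) (univ : Finset V), ind A σ * ∑ i ∈ σᶜ, W (insert i σ) *
      ∑ j ∈ σ, ind H (σ.erase j) * (1 - ind A (insert i (σ.erase j))) with hX2
  have hX2ge : (D - 1) * (α * (1 - lam) * HH) ≤ X2 := by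
    have := L_E (m+1) W (ind A) (ind H) (fun τ => 1 - ind A τ)
    rw [hX2, ← this, hHH, mul_sum, mul_sum]
    apply sum_le_sum; intro τ hτ
    have e : ∑ u ∈ τᶜ, ∑ v ∈ (insert u τ)ᶜ, W (insert v (insert u τ)) * ind A (insert u τ) *
        (1 - ind A (insert v τ)) = (D - 1) * S τ - E τ := by
      rw [hS, hE]; unfold SS EE
      rw [mul_sum, ← sum_sub_distrib]
      apply sum_congr rfl; intro u hu
      rw [mem_compl] at hu
      have e2 : (D - 1) * (NN X (d+1) (insert u τ) * ind A (insert u τ)) =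
          ∑ v ∈ (insert u τ)ᶜ, W (insert v (insert u τ)) * ind A (insert u τ) := by
        rw [← sum_mul, NN_bal, card_insert_of_notMem hu, hDτ τ (hcd τ hτ)]; push_cast; ring
      rw [e2, ← sum_sub_distrib]
      apply sum_congr rfl; intros; ring
    rw [e]
    have := mul_le_mul_of_nonneg_left (hheavy τ hτ) (ind_nonneg H τ)
    linarith
  set C := ∑ σ ∈ powersetCard (m+2) (univ : Finset V), ind A σ * W σ *
      ∑ j ∈ σ, ∑ l ∈ σ.erase j, ind H (σ.erase j) * ind H (σ.erase l) with hC
  have hQsum : ∑ ω ∈ powersetCard m (univ : Finset V), ∑ u ∈ ωᶜ, S (insert u ω) =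
      (m + 2) * (m + 1) * 𝒜 := by
    have := L_F m W (ind A) (fun _ => 1)
    simp only [mul_one] at this
    rw [hS]; unfold SS
    rw [this, h𝒜, mul_sum]
    apply sum_congr rfl; intro σ hσ
    have hc := (mem_powersetCard.1 hσ).2
    have : ∀ j ∈ σ, ∑ l ∈ σ.erase j, (1:ℝ) = m + 1 := by
      intro j hj
      rw [sum_const, card_erase_of_mem hj, hc]; simp
    rw [sum_congr rfl this, sum_const, hc]; push_cast; simp; ring
  have hCle : C ≤ 3 * ε * ((m + 2) * (m + 1)) * 𝒜 := by
    rw [hC, ← L_F m W (ind A) (ind H)]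
    have hb := bad_bound X A d m hX hXd hk hA G (filter_subset _ _) ε hwnl.1
    have hF : ∀ ω ∈ powersetCard m (univ : Finset V), _ := fun ω hω =>
      F_bound X A H G d m hX hXd lam η ε hlse hlam0 hε0 hlamε hηε hk hA
        (fun τ hτ => (mem_filter.1 hτ).2)
        (fun ω hω => ⟨(mem_filter.1 (mem_filter.1 hω).1).1, (mem_filter.1 hω).2⟩) ω
        (mem_powersetCard.1 hω).2
    have hs := sum_le_sum hF
    rw [sum_add_distrib, ← mul_sum, hQsum] at hs
    refine hs.trans ?_
    linarith
  -- combinatorial step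
  have hbal : ∀ σ ∈ powersetCard (m+2) (univ : Finset V), ∑ i ∈ σᶜ, W (insert i σ) = (D - 1) * W σ := by
    intro σ hσ
    rw [NN_bal, (mem_powersetCard.1 hσ).2, hD]; push_cast; ring
  have hineq1 : X2 ≤ X1 + (D - 1) * C := by
    rw [hX1eq, hX2, hC, mul_sum, ← sum_add_distrib]
    apply sum_le_sum; intro σ hσ
    by_cases hσA : σ ∈ A
    · have : ind A σ = 1 := by simp [ind, hσA]
      rw [this, one_mul, one_mul, one_mul, ← mul_assoc, ← hbal σ hσ, sum_mul, ← sum_add_distrib]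
      apply sum_le_sum; intro i hi
      rw [mem_compl] at hi
      by_cases hz : W (insert i σ) = 0
      · rw [hz]; simp
      · obtain ⟨j, hj, hjA⟩ := exists_other hX hXd hk A hA hδ1 σ hσA i hi hz
        rw [← mul_add]
        apply mul_le_mul_of_nonneg_left _ (hW0 _)
        exact pt1 σ (fun j => ind H (σ.erase j)) (fun j => ind A (insert i (σ.erase j)))
          (fun _ => ind_01 _ _) (fun _ => ind_01 _ _) ⟨j, hj, by simp [ind, hjA]⟩
    · have : ind A σ = 0 := by simp [ind, hσA]
      rw [this]; simp
  have hineq2 : (D - 1) * 𝒜 ≤ X1 + (D - 1) * HH := by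
    rw [hX1eq, hHH2, h𝒜, mul_sum, mul_sum, ← sum_add_distrib]
    apply sum_le_sum; intro σ hσ
    by_cases hσA : σ ∈ A
    · have : ind A σ = 1 := by simp [ind, hσA]
      rw [this, one_mul, one_mul, ← mul_assoc, ← hbal σ hσ, sum_mul, ← sum_add_distrib]
      apply sum_le_sum; intro i hi
      rw [mem_compl] at hi
      by_cases hz : W (insert i σ) = 0
      · rw [hz]; simp
      · obtain ⟨j, hj, hjA⟩ := exists_other hX hXd hk A hA hδ1 σ hσA i hi hz
        rw [← mul_add]
        apply le_mul_of_one_le_right (hW0 _)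
        exact pt2 σ (fun j => ind H (σ.erase j)) (fun j => ind A (insert i (σ.erase j)))
          (fun _ => ind_01 _ _) (fun _ => ind_01 _ _) ⟨j, hj, by simp [ind, hjA]⟩
    · have : ind A σ = 0 := by simp [ind, hσA]
      rw [this]; simp
  have hDp : 0 < D - 1 := by linarith
  have g1 : α * (1 - lam) * HH ≤ (ε + lam) * L + C := by
    apply le_of_mul_le_mul_left _ hDp
    linarith
  have g2 : 𝒜 ≤ (ε + lam) * L + HH := by
    apply le_of_mul_le_mul_left _ hDp
    linarith
  refine final_arith d (m+1) lam ε α 𝒜 HH L C (by omega) hk hε0 hα0 hα1 hlam0 hεα hlamε h𝒜0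
    ?_ g1 g2 ?_
  · push_cast; linarith
  · push_cast; linarith
end HDX

/-- in a `d`-dimensional `λ`-local spectral expander, with
`ε ≤ α/(3d³)`, `λ ≤ ε²` and `η ≤ ε³`, any `(η,ε,α)`-weakly-non-local `A ⊆ X(k)`
(`1 ≤ k ≤ d-1`) with `‖δ₁(A)‖ = 0` is empty. -/
theorem stmt13 {V : Type*} [Fintype V] [DecidableEq V]
    (X : Finset (Finset V)) (d : ℕ) (lam η ε α : ℝ)
    (hX : HDX.IsComplex X) (hXd : HDX.IsPureDim X d)
    (hlse : HDX.IsLocalSpectralExpander X d lam)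
    (hlam0 : 0 < lam) (hlam1 : lam < 1)
    (hη0 : 0 < η) (hη1 : η < 1) (hε0 : 0 < ε) (hε1 : ε < 1) (hα0 : 0 < α) (hα1 : α < 1)
    (hεα : ε ≤ α / (3 * (d : ℝ) ^ 3)) (hlamε : lam ≤ ε ^ 2) (hηε : η ≤ ε ^ 3)
    (k : ℕ) (hk1 : 1 ≤ k) (hk : k + 1 ≤ d)
    (A : Finset (Finset V)) (hA : A ⊆ HDX.facesCard X (k + 1))
    (hwnl : HDX.IsWeaklyNonlocal X (d + 1) k A η ε α)
    (hδ1 : HDX.wt X (d + 1) (k + 2) (HDX.delta1 X (k + 1) A) = 0) :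
    A = ∅ := by
  obtain ⟨m, rfl⟩ : ∃ m, k = m + 1 := ⟨k - 1, by omega⟩
  exact HDX.core X d lam η ε α hX hXd hlse hlam0 hlam1 hε0 hα0 hα1 hεα hlamε hηε m hk A hA hwnl hδ1
end
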